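/- Assume n > p and the dimension condition (★). Let u be a stable regular solution of −Δ_p u = f(u) in the unit ball B₁ ⊂ ℝⁿ, with f ∈ C¹(ℝ). Then there exists a constant C, depending only on n and p, such that for every ρ ∈ (0, 2/3): ∫_{B_ρ} r^{p−n} |∇u|^{p−2} u_r² dx ≤ C ρ^{p−n} ∫_{B_{3ρ/2} \ B_ρ} |∇u|^p dx. -/

import Mathlib

open MeasureTheory Metric Set Filter
open scoped RealInnerProductSpace

noncomputable section

abbrev Euc (n : ℕ) := EuclideanSpace ℝ (Fin n)

/-- `u` is a regular solution of `−Δ_p u = f(u)` in the open set `U ⊆ ℝⁿ`: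
`u ∈ C¹(U)`, `f ∘ u ∈ L^∞(U)`, and the equation holds in the weak sense against
all `C¹` test functions with compact support in `U`. -/
def IsRegularSolution (n : ℕ) (p : ℝ) (U : Set (Euc n)) (f : ℝ → ℝ) (u : Euc n → ℝ) : Prop :=
  ContDiffOn ℝ 1 u U ∧
  (∃ C : ℝ, ∀ x ∈ U, |f (u x)| ≤ C) ∧
  ∀ ξ : Euc n → ℝ, ContDiff ℝ 1 ξ → HasCompactSupport ξ → tsupport ξ ⊆ U →
    ∫ x in U, ‖gradient u x‖ ^ (p - 2) * ⟪gradient u x, gradient ξ x⟫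
      = ∫ x in U, f (u x) * ξ x

/-- `u` is a stable regular solution of `−Δ_p u = f(u)` in `U`: the second variation of the
energy is nonnegative on all Lipschitz test functions with compact support in `U`. -/
def IsStableRegularSolution (n : ℕ) (p : ℝ) (U : Set (Euc n)) (f : ℝ → ℝ)
    (u : Euc n → ℝ) : Prop :=
  IsRegularSolution n p U f u ∧
  ∀ ξ : Euc n → ℝ, (∃ K, LipschitzWith K ξ) → HasCompactSupport ξ → tsupport ξ ⊆ U →
    0 ≤ (∫ x in U ∩ {y | 0 < ‖gradient u y‖},
          (‖gradient u x‖ ^ (p - 2) * ‖gradient ξ x‖ ^ 2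
            + (p - 2) * ‖gradient u x‖ ^ (p - 4) * ⟪gradient u x, gradient ξ x⟫ ^ 2))
        - ∫ x in U, deriv f (u x) * ξ x ^ 2

/-- The radial derivative `u_r(x) = (x/|x|)·∇u(x)` (junk value `0` at `x = 0`). -/
def radialDeriv {n : ℕ} (u : Euc n → ℝ) (x : Euc n) : ℝ := ⟪x, gradient u x⟫ / ‖x‖

/-- The dimension condition (★): `n < p + 4p/(p−1)` if `p ≥ 2`, and `n < 5p` if `1 < p < 2`. -/
def DimensionCondition (n : ℕ) (p : ℝ) : Prop :=
  (2 ≤ p → (n : ℝ) < p + 4 * p / (p - 1)) ∧ (p < 2 → (n : ℝ) < 5 * p)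

open scoped Topology Gradient

section Flux

variable {E : Type*} [NormedAddCommGroup E] [InnerProductSpace ℝ E]

/-- The `p`-Laplacian flux `|a|^{p-2} a`. -/
def pFlux (p : ℝ) (a : E) : E := ‖a‖ ^ (p - 2) • a

/-- The derivative of the `p`-Laplacian flux at `a ≠ 0`. -/
def pLin (p : ℝ) (a : E) : E →L[ℝ] E :=
  ‖a‖ ^ (p - 2) • ContinuousLinearMap.id ℝ E
    + ((p - 2) * ‖a‖ ^ (p - 4)) • (innerSL ℝ a).smulRight a

/-- The quadratic form of `pLin`. -/
def pQuad (p : ℝ) (a v : E) : ℝ :=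
  ‖a‖ ^ (p - 2) * ‖v‖ ^ 2 + (p - 2) * ‖a‖ ^ (p - 4) * ⟪a, v⟫ ^ 2

lemma pLin_apply (p : ℝ) (a v : E) :
    pLin p a v = ‖a‖ ^ (p - 2) • v + ((p - 2) * ‖a‖ ^ (p - 4) * ⟪a, v⟫) • a := by
  simp [pLin, smul_smul]

lemma inner_pLin_self (p : ℝ) (a v : E) : ⟪pLin p a v, v⟫ = pQuad p a v := by
  rw [pLin_apply, pQuad, inner_add_left, real_inner_smul_left, real_inner_smul_left,
    real_inner_self_eq_norm_sq]
  ring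

lemma inner_pLin_comm (p : ℝ) (a v w : E) : ⟪pLin p a v, w⟫ = ⟪pLin p a w, v⟫ := by
  simp only [pLin_apply, inner_add_left, real_inner_smul_left]
  rw [real_inner_comm v w]
  ring

lemma norm_rpow_sub_four_mul_inner_sq_le (p : ℝ) (a v : E) :
    ‖a‖ ^ (p - 4) * ⟪a, v⟫ ^ 2 ≤ ‖a‖ ^ (p - 2) * ‖v‖ ^ 2 := by
  rcases eq_or_ne a 0 with rfl | ha
  · simp only [inner_zero_left]
    have := Real.rpow_nonneg (norm_nonneg (0 : E)) (p - 2)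
    simp only [ne_eq, OfNat.ofNat_ne_zero, not_false_eq_true, zero_pow, mul_zero]
    positivity
  · have h0 : 0 < ‖a‖ := norm_pos_iff.2 ha
    have h : ‖a‖ ^ (p - 2) = ‖a‖ ^ (p - 4) * ‖a‖ ^ 2 := by
      rw [← Real.rpow_natCast, ← Real.rpow_add h0]
      norm_num
      congr 1; ring
    have h1 : ⟪a, v⟫ ^ 2 ≤ ‖a‖ ^ 2 * ‖v‖ ^ 2 := by
      rw [← mul_pow, ← sq_abs]
      exact pow_le_pow_left₀ (abs_nonneg _) (abs_real_inner_le_norm a v) 2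
    rw [h, mul_assoc]
    exact mul_le_mul_of_nonneg_left h1 (Real.rpow_nonneg h0.le _)

lemma pQuad_le (p : ℝ) (a v : E) :
    pQuad p a v ≤ max 1 (p - 1) * (‖a‖ ^ (p - 2) * ‖v‖ ^ 2) := by
  have h := norm_rpow_sub_four_mul_inner_sq_le p a v
  have h0 : 0 ≤ ‖a‖ ^ (p - 4) * ⟪a, v⟫ ^ 2 :=
    mul_nonneg (Real.rpow_nonneg (norm_nonneg _) _) (sq_nonneg _)
  have h1 : 0 ≤ ‖a‖ ^ (p - 2) * ‖v‖ ^ 2 := h0.trans h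
  rw [pQuad, mul_assoc]
  rcases le_total p 2 with h2 | h2
  · nlinarith [le_max_left 1 (p - 1), mul_nonneg (sub_nonneg.2 h2) h0,
      mul_le_mul_of_nonneg_right (le_max_left 1 (p - 1)) h1]
  · nlinarith [mul_le_mul_of_nonneg_left h (sub_nonneg.2 h2),
      mul_le_mul_of_nonneg_right (le_max_right 1 (p - 1)) h1]

lemma le_pQuad (p : ℝ) (a v : E) :
    min 1 (p - 1) * (‖a‖ ^ (p - 2) * ‖v‖ ^ 2) ≤ pQuad p a v := by
  have h := norm_rpow_sub_four_mul_inner_sq_le p a v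
  have h0 : 0 ≤ ‖a‖ ^ (p - 4) * ⟪a, v⟫ ^ 2 :=
    mul_nonneg (Real.rpow_nonneg (norm_nonneg _) _) (sq_nonneg _)
  have h1 : 0 ≤ ‖a‖ ^ (p - 2) * ‖v‖ ^ 2 := h0.trans h
  rw [pQuad, mul_assoc]
  rcases le_total p 2 with h2 | h2
  · nlinarith [mul_le_mul_of_nonneg_left h (sub_nonneg.2 h2),
      mul_le_mul_of_nonneg_right (min_le_right 1 (p - 1)) h1]
  · nlinarith [mul_nonneg (sub_nonneg.2 h2) h0,
      mul_le_mul_of_nonneg_right (min_le_left 1 (p - 1)) h1]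

lemma norm_pLin_apply_le (p : ℝ) (a v : E) :
    ‖pLin p a v‖ ≤ (1 + |p - 2|) * ‖a‖ ^ (p - 2) * ‖v‖ := by
  rw [pLin_apply]
  have h0 : 0 ≤ ‖a‖ ^ (p - 2) := Real.rpow_nonneg (norm_nonneg _) _
  have h4 : 0 ≤ ‖a‖ ^ (p - 4) := Real.rpow_nonneg (norm_nonneg _) _
  have h : ‖a‖ ^ (p - 4) * |⟪a, v⟫| * ‖a‖ ≤ ‖a‖ ^ (p - 2) * ‖v‖ := by
    rcases eq_or_ne a 0 with rfl | ha
    · simp only [inner_zero_left, abs_zero, mul_zero, norm_zero]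
      exact mul_nonneg (by simpa using h0) (norm_nonneg _)
    · have ha0 : 0 < ‖a‖ := norm_pos_iff.2 ha
      have h : ‖a‖ ^ (p - 2) = ‖a‖ ^ (p - 4) * ‖a‖ ^ 2 := by
        rw [← Real.rpow_natCast, ← Real.rpow_add ha0]
        norm_num
        congr 1; ring
      rw [h]
      nlinarith [mul_le_mul_of_nonneg_left (abs_real_inner_le_norm a v)
        (mul_nonneg h4 ha0.le)]
  refine (norm_add_le _ _).trans ?_
  rw [norm_smul, norm_smul, Real.norm_eq_abs, Real.norm_eq_abs, abs_of_nonneg h0, abs_mul,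
    abs_mul, abs_of_nonneg h4]
  nlinarith [mul_le_mul_of_nonneg_left h (abs_nonneg (p - 2))]

lemma inner_pFlux_self {p : ℝ} (hp : 1 < p) (a : E) : ⟪pFlux p a, a⟫ = ‖a‖ ^ p := by
  rw [pFlux, real_inner_smul_left, real_inner_self_eq_norm_sq]
  rcases eq_or_ne a 0 with rfl | ha
  · simp [Real.zero_rpow (by linarith : p ≠ 0)]
  · rw [← Real.rpow_natCast, ← Real.rpow_add (norm_pos_iff.2 ha)]
    norm_num

lemma norm_pFlux {p : ℝ} (hp : 1 < p) (a : E) : ‖pFlux p a‖ = ‖a‖ ^ (p - 1) := by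
  rw [pFlux, norm_smul, Real.norm_eq_abs, abs_of_nonneg (Real.rpow_nonneg (norm_nonneg _) _)]
  rcases eq_or_ne a 0 with rfl | ha
  · simp [Real.zero_rpow (by linarith : p - 1 ≠ 0)]
  · nth_rewrite 2 [← Real.rpow_one ‖a‖]
    rw [← Real.rpow_add (norm_pos_iff.2 ha)]
    congr 1; ring

lemma pFlux_smul {p l : ℝ} (hl : 0 < l) (a : E) :
    pFlux p (l • a) = l ^ (p - 1) • pFlux p a := by
  rw [pFlux, pFlux, norm_smul, Real.norm_eq_abs, abs_of_pos hl,
    Real.mul_rpow hl.le (norm_nonneg _), smul_smul, smul_smul]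
  congr 1
  have : l ^ (p - 1) = l ^ (p - 2) * l := by
    nth_rewrite 3 [← Real.rpow_one l]
    rw [← Real.rpow_add hl]
    congr 1; ring
  rw [this]
  ring

lemma continuous_pFlux [CompleteSpace E] {p : ℝ} (hp : 1 < p) : Continuous (pFlux p : E → E) := by
  have h : (pFlux p : E → E) = fun a => p⁻¹ • ∇ (fun x : E => ‖x‖ ^ p) a := by
    funext a
    have h1 : HasGradientAt (fun x : E => ‖x‖ ^ p) (p • pFlux p a) a := by
      rw [hasGradientAt_iff_hasFDerivAt]
      refine (hasFDerivAt_norm_rpow a hp).congr_fderiv ?_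
      ext v
      simp [pFlux, mul_assoc]
    rw [h1.gradient, smul_smul, inv_mul_cancel₀ (by linarith), one_smul]
  rw [h]
  refine continuous_const.smul ?_
  exact (InnerProductSpace.toDual ℝ E).symm.continuous.comp
    ((contDiff_norm_rpow hp).continuous_fderiv one_ne_zero)

lemma mul_inner_pFlux_sub_le {p : ℝ} (hp : 1 < p) (a b : E) :
    p * ⟪pFlux p a, b - a⟫ ≤ ‖b‖ ^ p - ‖a‖ ^ p := by
  rw [inner_sub_right, inner_pFlux_self hp]
  have h1 : ⟪pFlux p a, b⟫ ≤ ‖a‖ ^ (p - 1) * ‖b‖ :=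
    (real_inner_le_norm _ _).trans_eq (by rw [norm_pFlux hp])
  have hq : (p.conjExponent).HolderConjugate p := (Real.HolderConjugate.conjExponent hp).symm
  have h2 := Real.young_inequality_of_nonneg (Real.rpow_nonneg (norm_nonneg a) (p - 1))
    (norm_nonneg b) hq
  rw [← Real.rpow_mul (norm_nonneg a)] at h2
  have hpc : p.conjExponent = p / (p - 1) := rfl
  have hp1 : p - 1 ≠ 0 := by linarith
  have e1 : (p - 1) * p.conjExponent = p := by rw [hpc]; field_simp
  rw [e1] at h2
  have h3 : p * (‖a‖ ^ p / p.conjExponent + ‖b‖ ^ p / p) = (p - 1) * ‖a‖ ^ p + ‖b‖ ^ p := by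
    have hp0 : p ≠ 0 := by linarith
    rw [hpc]; field_simp
  nlinarith [mul_le_mul_of_nonneg_left (h1.trans h2) (by linarith : (0:ℝ) ≤ p)]

lemma hasFDerivAt_norm_rpow_of_ne (r : ℝ) {a : E} (ha : a ≠ 0) :
    HasFDerivAt (fun x : E => ‖x‖ ^ r) ((r * ‖a‖ ^ (r - 2)) • innerSL ℝ a) a := by
  have h0 : 0 < ‖a‖ := norm_pos_iff.2 ha
  have h := (hasStrictFDerivAt_norm_sq a).hasFDerivAt.rpow_const (p := r / 2)
    (Or.inl (by positivity))
  have e : ∀ x : E, (‖x‖ ^ 2) ^ (r / 2) = ‖x‖ ^ r := fun x => by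
    rw [← Real.rpow_natCast, ← Real.rpow_mul (norm_nonneg _)]
    congr 1; push_cast; ring
  simp only [e] at h
  convert h using 1
  rw [← Real.rpow_natCast ‖a‖ 2, ← Real.rpow_mul (norm_nonneg _)]
  rw [show ((2 : ℕ) : ℝ) * (r / 2 - 1) = r - 2 by push_cast; ring]
  ext v
  simp
  ring

lemma hasFDerivAt_pFlux (p : ℝ) {a : E} (ha : a ≠ 0) :
    HasFDerivAt (pFlux p) (pLin p a) a := by
  have h := (hasFDerivAt_norm_rpow_of_ne (p - 2) ha).smul (hasFDerivAt_id a)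
  refine h.congr_fderiv ?_
  ext v
  rw [pLin_apply, show p - 2 - 2 = p - 4 by ring]
  simp

lemma continuousOn_pLin (p : ℝ) : ContinuousOn (pLin p : E → E →L[ℝ] E) {0}ᶜ := by
  have h : ∀ r : ℝ, ContinuousOn (fun a : E => ‖a‖ ^ r) {0}ᶜ := fun r =>
    continuous_norm.continuousOn.rpow_const fun a ha => Or.inl (norm_ne_zero_iff.2 ha)
  refine ((h _).smul continuousOn_const).add ((continuousOn_const.mul (h _)).smul ?_)
  have : Continuous fun a : E => (innerSL ℝ a).smulRight a := by fun_prop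
  exact this.continuousOn

/-- Uniform first order expansion of the flux away from the origin. -/
lemma exists_norm_pFlux_sub_sub_le [FiniteDimensional ℝ E] (p : ℝ) {d M w : ℝ}
    (hd : 0 < d) (hw : 0 < w) :
    ∃ s > 0, ∀ a b : E, d ≤ ‖a‖ → ‖a‖ ≤ M → ‖b - a‖ < s →
      ‖pFlux p b - pFlux p a - pLin p a (b - a)‖ ≤ w * ‖b - a‖ := by
  have hK : IsCompact (closedBall (0 : E) (M + d) \ ball 0 (d / 2)) :=
    (isCompact_closedBall _ _).diff isOpen_ball
  have hmem : ∀ x : E, ‖x‖ ≤ M + d → d / 2 ≤ ‖x‖ →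
      x ∈ closedBall (0 : E) (M + d) \ ball 0 (d / 2) := fun x h1 h2 =>
    ⟨by simpa using h1, by simpa using h2⟩
  have hcont : ContinuousOn (pLin p : E → E →L[ℝ] E)
      (closedBall (0 : E) (M + d) \ ball 0 (d / 2)) := by
    refine (continuousOn_pLin p).mono fun x hx => ?_
    rintro rfl
    exact hx.2 (by simpa using hd)
  have huc := hK.uniformContinuousOn_of_continuous hcont
  rw [Metric.uniformContinuousOn_iff] at huc
  obtain ⟨s, hs, H⟩ := huc w hw
  refine ⟨min s (d / 2), lt_min hs (by linarith), fun a b hda haM hab => ?_⟩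
  have hball : ∀ x ∈ ball a (min s (d / 2)), d / 2 ≤ ‖x‖ ∧ ‖x‖ ≤ M + d := by
    intro x hx
    rw [mem_ball_iff_norm, lt_min_iff] at hx
    have h1 := norm_sub_norm_le a x
    have h2 := norm_sub_norm_le x a
    rw [norm_sub_rev] at h1
    constructor <;> linarith [hx.2]
  refine Convex.norm_image_sub_le_of_norm_hasFDerivWithin_le' (f := pFlux p) (f' := pLin p)
    (s := ball a (min s (d / 2))) (fun x hx => ?_) (fun x hx => ?_) (convex_ball _ _)
    (mem_ball_self (lt_min hs (by linarith))) (mem_ball_iff_norm.2 hab)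
  · refine (hasFDerivAt_pFlux p ?_).hasFDerivWithinAt
    rintro rfl
    have := (hball _ hx).1
    simp at this
    linarith
  · have := H x (hmem x (hball x hx).2 (hball x hx).1) a (hmem a (by linarith) (by linarith))
      ((mem_ball.1 hx).trans_le (min_le_left _ _))
    rw [dist_eq_norm] at this
    exact this.le

/-- The algebraic core of the stability argument: a pointwise bound for the stability integrand
minus `(1 + m)` times the integrand of the linearised equation. -/
lemma stability_pointwise {p k K m w : ℝ} {a g e D : E} {T X Y : ℝ}
    (hk : 0 < k) (hkK : k ≤ K) (hm : 0 < m) (hm1 : m ≤ 1) (hw : w ≤ m * k / 4)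
    (hell : ∀ v, k * ‖v‖ ^ 2 ≤ pQuad p a v) (hbd : ∀ v, ‖pLin p a v‖ ≤ K * ‖v‖)
    (hD : ‖D - pLin p a g‖ ≤ w * ‖g‖) (hY : 0 ≤ Y) :
    pQuad p a (X • g + T • e) - (1 + m) * ⟪D, (X ^ 2 + Y) • g + (2 * (X * T)) • e⟫
      ≤ T ^ 2 * pQuad p a e + 5 * K ^ 2 / k * m * (T ^ 2 * ‖e‖ ^ 2) := by
  obtain ⟨F, hF⟩ : ∃ F, D = pLin p a g + F := ⟨D - pLin p a g, by abel⟩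
  have hFn : ‖F‖ ≤ w * ‖g‖ := by rwa [hF, add_sub_cancel_left] at hD
  subst hF
  have hquad : pQuad p a (X • g + T • e)
      = X ^ 2 * pQuad p a g + 2 * (X * T) * ⟪pLin p a g, e⟫ + T ^ 2 * pQuad p a e := by
    simp only [← inner_pLin_self, map_add, map_smul, inner_add_left, inner_add_right,
      real_inner_smul_left, real_inner_smul_right]
    rw [inner_pLin_comm p a e g]
    ring
  rw [hquad]
  simp only [inner_add_left, inner_add_right, real_inner_smul_right, inner_pLin_self]
  have hge := hell g
  have hFg : |⟪F, g⟫| ≤ w * ‖g‖ ^ 2 := (abs_real_inner_le_norm F g).trans (by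
    nlinarith [norm_nonneg g])
  have hFe : |⟪F, e⟫| ≤ w * (‖g‖ * ‖e‖) := (abs_real_inner_le_norm F e).trans (by
    nlinarith [norm_nonneg e])
  have hAe : |⟪pLin p a g, e⟫| ≤ K * (‖g‖ * ‖e‖) := (abs_real_inner_le_norm _ e).trans (by
    nlinarith [norm_nonneg e, hbd g])
  have hG : 0 ≤ ‖g‖ ^ 2 := sq_nonneg _
  have hmk : 0 < m * k := mul_pos hm hk
  have hwk : w ≤ k / 4 := hw.trans (by nlinarith)
  have hYpos : 0 ≤ Y * (pQuad p a g + ⟪F, g⟫) := by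
    refine mul_nonneg hY ?_
    nlinarith [neg_abs_le ⟪F, g⟫]
  set Z := |X| * ‖g‖ with hZ
  set W := |T| * ‖e‖ with hW
  have hZ2 : Z ^ 2 = X ^ 2 * ‖g‖ ^ 2 := by rw [hZ, mul_pow, sq_abs]
  have hW2 : W ^ 2 = T ^ 2 * ‖e‖ ^ 2 := by rw [hW, mul_pow, sq_abs]
  have hZW : 0 ≤ Z * W := by positivity
  have i1 : -(X ^ 2 * ⟪F, g⟫) ≤ m * k / 4 * Z ^ 2 := by
    rw [hZ2]
    have h1 : -⟪F, g⟫ ≤ m * k / 4 * ‖g‖ ^ 2 := by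
      linarith [neg_abs_le ⟪F, g⟫, mul_le_mul_of_nonneg_right hw hG]
    linarith [mul_le_mul_of_nonneg_left h1 (sq_nonneg X)]
  have i2 : -(X * T * ⟪F, e⟫) ≤ m * k / 4 * (Z * W) := by
    refine (neg_le_abs _).trans ?_
    rw [abs_mul, abs_mul, hZ, hW]
    have h1 : |⟪F, e⟫| ≤ m * k / 4 * (‖g‖ * ‖e‖) :=
      hFe.trans (mul_le_mul_of_nonneg_right hw (by positivity))
    linarith [mul_le_mul_of_nonneg_left h1 (by positivity : 0 ≤ |X| * |T|)]
  have i3 : -(X * T * ⟪pLin p a g, e⟫) ≤ K * (Z * W) := by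
    refine (neg_le_abs _).trans ?_
    rw [abs_mul, abs_mul, hZ, hW]
    linarith [mul_le_mul_of_nonneg_left hAe (by positivity : 0 ≤ |X| * |T|)]
  have i4 : k * Z ^ 2 ≤ X ^ 2 * pQuad p a g := by
    rw [hZ2]; linarith [mul_le_mul_of_nonneg_left hge (sq_nonneg X)]
  rw [← hW2]
  have hK : 0 < K := hk.trans_le hkK
  clear_value Z W
  generalize ⟪F, g⟫ = r1 at *
  generalize ⟪F, e⟫ = r2 at *
  generalize ⟪pLin p a g, e⟫ = r3 at *
  generalize pQuad p a g = r4 at *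
  generalize pQuad p a e = r5 at *
  clear hell hbd hFn hge hFg hFe hAe hquad hZ hW hZ2 hW2
  have i5 : 3 * K * (Z * W) ≤ k / 2 * Z ^ 2 + 5 * K ^ 2 / k * W ^ 2 := by
    have : 0 ≤ k / 2 * (Z - 3 * K / k * W) ^ 2 := by positivity
    have e1 : k / 2 * (Z - 3 * K / k * W) ^ 2
        = k / 2 * Z ^ 2 - 3 * K * (Z * W) + 9 / 2 * (K ^ 2 / k * W ^ 2) := by
      field_simp
      ring
    have : 0 ≤ K ^ 2 / k * W ^ 2 := by positivity
    have e2 : 5 * K ^ 2 / k * W ^ 2 = 5 * (K ^ 2 / k * W ^ 2) := by ring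
    rw [e2]
    linarith
  have j1 := mul_le_mul_of_nonneg_left i1 (by linarith : (0 : ℝ) ≤ 1 + m)
  have j2 := mul_le_mul_of_nonneg_left i2 (by linarith : (0 : ℝ) ≤ 2 * (1 + m))
  have j3 := mul_le_mul_of_nonneg_left i3 (by linarith : (0 : ℝ) ≤ 2 * m)
  have j4 := mul_le_mul_of_nonneg_left i4 hm.le
  have j5 := mul_le_mul_of_nonneg_left i5 hm.le
  have j6 := mul_nonneg (by linarith : (0 : ℝ) ≤ 1 + m) hYpos
  have j7 : (1 + m) * (m * k / 4 * Z ^ 2) ≤ m * k / 2 * Z ^ 2 := by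
    have := mul_nonneg (sub_nonneg.2 hm1) (mul_nonneg hmk.le (sq_nonneg Z))
    linarith
  have j8 : 2 * (1 + m) * (m * k / 4 * (Z * W)) ≤ m * K * (Z * W) := by
    have h1 : m * k * (Z * W) ≤ m * K * (Z * W) := by gcongr
    have := mul_nonneg (sub_nonneg.2 hm1) (mul_nonneg hmk.le hZW)
    linarith
  have e3 : 5 * K ^ 2 / k * m * W ^ 2 = m * (5 * K ^ 2 / k * W ^ 2) := by ring
  rw [e3]
  linarith

end Flux

section Truncation

/-- A smooth even cutoff vanishing on `[-e, e]` and equal to `1` far from the origin. -/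
def cutoffFun (e t : ℝ) : ℝ := Real.smoothTransition (t ^ 2 / e ^ 2 - 1)

/-- The primitive of `cutoffFun`, a smooth odd truncation of the identity. -/
def truncFun (e s : ℝ) : ℝ := ∫ t in (0 : ℝ)..s, cutoffFun e t

lemma contDiff_cutoffFun (e : ℝ) : ContDiff ℝ 1 (cutoffFun e) := by
  have h : ContDiff ℝ 1 Real.smoothTransition := Real.smoothTransition.contDiff (n := 1)
  exact h.comp (((contDiff_id.pow 2).div_const _).sub contDiff_const)

lemma cutoffFun_nonneg (e t : ℝ) : 0 ≤ cutoffFun e t := Real.smoothTransition.nonneg _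

lemma cutoffFun_le_one (e t : ℝ) : cutoffFun e t ≤ 1 := Real.smoothTransition.le_one _

lemma hasDerivAt_truncFun (e s : ℝ) : HasDerivAt (truncFun e) (cutoffFun e s) s :=
  (contDiff_cutoffFun e).continuous.integral_hasStrictDerivAt 0 s |>.hasDerivAt

lemma contDiff_truncFun (e : ℝ) : ContDiff ℝ 1 (truncFun e) := by
  rw [contDiff_one_iff_deriv]
  refine ⟨fun s => (hasDerivAt_truncFun e s).differentiableAt, ?_⟩
  rw [show deriv (truncFun e) = cutoffFun e from
    funext fun s => (hasDerivAt_truncFun e s).deriv]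
  exact (contDiff_cutoffFun e).continuous

lemma hasDerivAt_cutoffFun (e s : ℝ) :
    HasDerivAt (cutoffFun e) (deriv (cutoffFun e) s) s :=
  ((contDiff_cutoffFun e).differentiable one_ne_zero s).hasDerivAt

lemma cutoffFun_eq_zero {e s : ℝ} (he : 0 < e) (h : |s| ≤ e) : cutoffFun e s = 0 := by
  refine Real.smoothTransition.zero_of_nonpos ?_
  rw [sub_nonpos, div_le_one (by positivity), ← sq_abs]
  exact pow_le_pow_left₀ (abs_nonneg _) h 2

lemma cutoffFun_eq_one {e s : ℝ} (he : 0 < e) (h : 2 * e ≤ |s|) : cutoffFun e s = 1 := by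
  refine Real.smoothTransition.one_of_one_le ?_
  rw [le_sub_iff_add_le, le_div_iff₀ (by positivity), ← sq_abs s]
  nlinarith

lemma truncFun_eq_zero {e s : ℝ} (he : 0 < e) (h : |s| ≤ e) : truncFun e s = 0 := by
  rw [truncFun, intervalIntegral.integral_congr (g := fun _ => 0) (fun t ht => ?_),
    intervalIntegral.integral_zero]
  refine cutoffFun_eq_zero he (le_trans ?_ h)
  rcases le_total 0 s with hs | hs
  · rw [uIcc_of_le hs] at ht
    rw [abs_of_nonneg ht.1, abs_of_nonneg hs]; exact ht.2
  · rw [uIcc_of_ge hs] at ht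
    rw [abs_of_nonpos ht.2, abs_of_nonpos hs]; linarith [ht.1]

lemma abs_truncFun_le (e s : ℝ) : |truncFun e s| ≤ |s| := by
  have h := intervalIntegral.norm_integral_le_of_norm_le_const (a := 0) (b := s)
    (f := cutoffFun e) (C := 1) fun t _ => by
      rw [Real.norm_eq_abs, abs_of_nonneg (cutoffFun_nonneg e t)]
      exact cutoffFun_le_one e t
  simpa [truncFun] using h

lemma truncFun_sub_le {e : ℝ} (he : 0 < e) (s : ℝ) : |truncFun e s - s| ≤ 2 * e := by
  have hInt : ∀ a b, IntervalIntegrable (fun t => cutoffFun e t - 1) volume a b := fun a b =>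
    ((contDiff_cutoffFun e).continuous.sub continuous_const).intervalIntegrable a b
  have key : truncFun e s - s = ∫ t in (0 : ℝ)..s, (cutoffFun e t - 1) := by
    rw [intervalIntegral.integral_sub ((contDiff_cutoffFun e).continuous.intervalIntegrable _ _)
      (by simp)]
    simp [truncFun]
  have hb : ∀ t, ‖cutoffFun e t - 1‖ ≤ 1 := fun t => by
    rw [Real.norm_eq_abs, abs_le]
    constructor <;> linarith [cutoffFun_nonneg e t, cutoffFun_le_one e t]
  rcases le_total |s| (2 * e) with h | h
  · rw [key]
    have := intervalIntegral.norm_integral_le_of_norm_le_const (a := 0) (b := s)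
      (f := fun t => cutoffFun e t - 1) (C := 1) fun t _ => hb t
    simp only [Real.norm_eq_abs, sub_zero, one_mul] at this
    exact this.trans h
  · obtain ⟨q, hq, hq0⟩ : ∃ q, |q| = 2 * e ∧ ∫ t in q..s, (cutoffFun e t - 1) = 0 := by
      rcases le_total 0 s with hs | hs
      · rw [abs_of_nonneg hs] at h
        refine ⟨2 * e, abs_of_pos (by linarith), ?_⟩
        rw [intervalIntegral.integral_congr (g := fun _ => 0) (fun t ht => ?_),
          intervalIntegral.integral_zero]
        rw [uIcc_of_le h] at ht
        simp [cutoffFun_eq_one he (ht.1.trans (le_abs_self t))]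
      · rw [abs_of_nonpos hs] at h
        refine ⟨-(2 * e), by rw [abs_neg]; exact abs_of_pos (by linarith), ?_⟩
        rw [intervalIntegral.integral_congr (g := fun _ => 0) (fun t ht => ?_),
          intervalIntegral.integral_zero]
        rw [uIcc_of_ge (by linarith)] at ht
        simp [cutoffFun_eq_one he (le_trans (by linarith [ht.2]) (neg_le_abs t))]
    rw [key, ← intervalIntegral.integral_add_adjacent_intervals (hInt 0 q) (hInt q s), hq0,
      add_zero]
    have := intervalIntegral.norm_integral_le_of_norm_le_const (a := 0) (b := q)
      (f := fun t => cutoffFun e t - 1) (C := 1) fun t _ => hb t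
    simp only [Real.norm_eq_abs, sub_zero, one_mul] at this
    exact this.trans hq.le

lemma truncFun_mul_self_nonneg (e s : ℝ) : 0 ≤ truncFun e s * s := by
  rcases le_total 0 s with hs | hs
  · exact mul_nonneg (intervalIntegral.integral_nonneg hs fun t _ => cutoffFun_nonneg e t) hs
  · refine mul_nonneg_of_nonpos_of_nonpos ?_ hs
    rw [truncFun, intervalIntegral.integral_symm, neg_nonpos]
    exact intervalIntegral.integral_nonneg hs fun t _ => cutoffFun_nonneg e t

lemma truncFun_mul_deriv_cutoffFun_nonneg (e s : ℝ) :
    0 ≤ truncFun e s * deriv (cutoffFun e) s := by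
  have h1 : HasDerivAt (fun t : ℝ => t ^ 2 / e ^ 2 - 1) (2 * s / e ^ 2) s := by
    simpa using ((hasDerivAt_pow 2 s).div_const (e ^ 2)).sub_const 1
  have h2 := ((Real.smoothTransition.contDiff (n := 1)).differentiable one_ne_zero
    (s ^ 2 / e ^ 2 - 1)).hasDerivAt
  have h3 : deriv (cutoffFun e) s
      = deriv Real.smoothTransition (s ^ 2 / e ^ 2 - 1) * (2 * s / e ^ 2) :=
    (h2.comp s h1).deriv
  have h4 : 0 ≤ deriv Real.smoothTransition (s ^ 2 / e ^ 2 - 1) :=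
    Real.smoothTransition.monotone.deriv_nonneg
  rw [h3, show truncFun e s * (deriv Real.smoothTransition (s ^ 2 / e ^ 2 - 1) * (2 * s / e ^ 2))
    = deriv Real.smoothTransition (s ^ 2 / e ^ 2 - 1) * (2 / e ^ 2) * (truncFun e s * s) by ring]
  exact mul_nonneg (mul_nonneg h4 (by positivity)) (truncFun_mul_self_nonneg e s)

lemma tendsto_truncFun (s : ℝ) : Tendsto (fun e => truncFun e s) (𝓝[>] 0) (𝓝 s) := by
  rw [tendsto_iff_norm_sub_tendsto_zero]
  refine squeeze_zero' (g := fun e : ℝ => 2 * e) (Eventually.of_forall fun _ => norm_nonneg _) ?_ ?_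
  · filter_upwards [self_mem_nhdsWithin] with e he
    exact truncFun_sub_le he s
  · have : Tendsto (fun e : ℝ => 2 * e) (𝓝 0) (𝓝 (2 * 0)) := tendsto_id.const_mul 2
    rw [mul_zero] at this
    exact this.mono_left nhdsWithin_le_nhds

lemma tendsto_cutoffFun {s : ℝ} (hs : s ≠ 0) :
    Tendsto (fun e => cutoffFun e s) (𝓝[>] 0) (𝓝 1) := by
  refine tendsto_const_nhds.congr' ?_
  have h : Iio (|s| / 2) ∈ 𝓝[>] (0 : ℝ) :=
    mem_nhdsWithin_of_mem_nhds (Iio_mem_nhds (by have := abs_pos.2 hs; linarith))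
  filter_upwards [self_mem_nhdsWithin, h] with e he he2
  exact (cutoffFun_eq_one he (by have := mem_Iio.1 he2; linarith)).symm

end Truncation

section DilationQuotient

variable {E : Type*} [NormedAddCommGroup E] [InnerProductSpace ℝ E]

/-- The difference quotient of `u` along dilations. -/
def dilQuot (u : E → ℝ) (h : ℝ) (x : E) : ℝ := (u ((1 + h) • x) - u x) / h

lemma contDiff_dilQuot {u : E → ℝ} (hu : ContDiff ℝ 1 u) (h : ℝ) :
    ContDiff ℝ 1 (dilQuot u h) :=
  ((hu.comp (contDiff_const_smul (1 + h))).sub hu).div_const h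

end DilationQuotient

section GradientLemmas

variable {E : Type*} [NormedAddCommGroup E] [InnerProductSpace ℝ E] [CompleteSpace E]

lemma HasGradientAt.mul {f g : E → ℝ} {f' g' x : E} (hf : HasGradientAt f f' x)
    (hg : HasGradientAt g g' x) :
    HasGradientAt (fun y => f y * g y) (f x • g' + g x • f') x := by
  rw [hasGradientAt_iff_hasFDerivAt] at *
  refine (hf.mul hg).congr_fderiv ?_
  simp

lemma HasDerivAt.comp_hasGradientAt {φ : ℝ → ℝ} {f : E → ℝ} {φ' : ℝ} {f' x : E}
    (hφ : HasDerivAt φ φ' (f x)) (hf : HasGradientAt f f' x) :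
    HasGradientAt (fun y => φ (f y)) (φ' • f') x := by
  rw [hasGradientAt_iff_hasFDerivAt] at *
  refine (hφ.comp_hasFDerivAt x hf).congr_fderiv ?_
  simp

lemma HasGradientAt.comp_smul {f : E → ℝ} {f' x : E} (l : ℝ) (hf : HasGradientAt f f' (l • x)) :
    HasGradientAt (fun y => f (l • y)) (l • f') x := by
  rw [hasGradientAt_iff_hasFDerivAt] at *
  refine (hf.comp x ((hasFDerivAt_id x).const_smul l)).congr_fderiv ?_
  ext v
  simp

lemma ContDiff.hasGradientAt {f : E → ℝ} (hf : ContDiff ℝ 1 f) (x : E) :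
    HasGradientAt f (∇ f x) x :=
  (hf.differentiable one_ne_zero x).hasGradientAt

lemma ContDiff.continuous_gradient {f : E → ℝ} (hf : ContDiff ℝ 1 f) : Continuous (∇ f) :=
  (InnerProductSpace.toDual ℝ E).symm.continuous.comp (hf.continuous_fderiv one_ne_zero)

lemma gradient_eq_zero_of_norm_gt {f : E → ℝ} {r : ℝ} (h0 : ∀ x, r < ‖x‖ → f x = 0) {x : E}
    (hx : r < ‖x‖) : ∇ f x = 0 := by
  have : f =ᶠ[𝓝 x] fun _ => 0 := by
    filter_upwards [continuous_norm.continuousAt.eventually (lt_mem_nhds hx)] with y hy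
    exact h0 y hy
  rw [this.gradient_eq, gradient_fun_const]

lemma HasCompactSupport.gradient {f : E → ℝ} (hf : HasCompactSupport f) :
    HasCompactSupport (∇ f) :=
  (hf.fderiv (𝕜 := ℝ)).comp_left (g := (InnerProductSpace.toDual ℝ E).symm) (by simp)

/-- The gradient of `dilQuot`. -/
def dilQuotGrad (u : E → ℝ) (h : ℝ) (x : E) : E :=
  h⁻¹ • ((1 + h) • ∇ u ((1 + h) • x) - ∇ u x)

lemma hasGradientAt_dilQuot {u : E → ℝ} (hu : ContDiff ℝ 1 u) (h : ℝ) (x : E) :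
    HasGradientAt (dilQuot u h) (dilQuotGrad u h x) x := by
  have h1 := (hu.hasGradientAt ((1 + h) • x)).comp_smul (1 + h)
  have h2 := hu.hasGradientAt x
  rw [hasGradientAt_iff_hasFDerivAt] at *
  have h3 := (h1.sub h2).mul_const h⁻¹
  refine (h3.congr_fderiv ?_).congr_of_eventuallyEq ?_
  · simp [dilQuotGrad]
  · exact Eventually.of_forall fun y => div_eq_mul_inv _ _

lemma hasDerivAt_comp_one_add_smul {u : E → ℝ} (hu : ContDiff ℝ 1 u) (t : ℝ) (x : E) :
    HasDerivAt (fun s : ℝ => u ((1 + s) • x)) ⟪x, ∇ u ((1 + t) • x)⟫ t := by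
  have h1 := hu.hasGradientAt ((1 + t) • x)
  rw [hasGradientAt_iff_hasFDerivAt] at h1
  have h2 : HasDerivAt (fun s : ℝ => (1 + s) • x) x t := by
    simpa using ((hasDerivAt_id t).const_add 1).smul_const x
  refine (h1.comp_hasDerivAt t h2).congr_deriv ?_
  simp

lemma tendsto_dilQuot {u : E → ℝ} (hu : ContDiff ℝ 1 u) (x : E) :
    Tendsto (fun h => dilQuot u h x) (𝓝[>] 0) (𝓝 ⟪x, ∇ u x⟫) := by
  have h1 := hasDerivAt_comp_one_add_smul hu 0 x
  rw [hasDerivAt_iff_tendsto_slope_zero] at h1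
  simp only [add_zero, one_smul, zero_add] at h1
  refine (h1.mono_left (nhdsWithin_mono _ fun y hy => ne_of_gt hy)).congr fun h => ?_
  simp [dilQuot, div_eq_inv_mul]

lemma exists_dilQuot_eq {u : E → ℝ} (hu : ContDiff ℝ 1 u) {h : ℝ} (hh : 0 < h) (x : E) :
    ∃ t ∈ Ioo 0 h, dilQuot u h x = ⟪x, ∇ u ((1 + t) • x)⟫ := by
  obtain ⟨t, ht, he⟩ := exists_hasDerivAt_eq_slope (fun s : ℝ => u ((1 + s) • x))
    (fun s => ⟪x, ∇ u ((1 + s) • x)⟫) hh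
    (fun s _ => (hasDerivAt_comp_one_add_smul hu s x).continuousAt.continuousWithinAt)
    (fun s _ => hasDerivAt_comp_one_add_smul hu s x)
  refine ⟨t, ht, ?_⟩
  rw [he]
  simp [dilQuot]

end GradientLemmas

section Integrability

variable {n : ℕ}

lemma integrable_of_bound {F : Euc n → ℝ} {C r : ℝ} (hF : Measurable F)
    (hC : ∀ x, ‖F x‖ ≤ C) (h0 : ∀ x, r < ‖x‖ → F x = 0) : Integrable F := by
  have hs : Function.support F ⊆ closedBall 0 r := fun x hx => by
    by_contra hc
    exact hx (h0 x (by simpa using hc))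
  rw [← integrableOn_iff_integrable_of_support_subset hs]
  exact Measure.integrableOn_of_bounded (measure_closedBall_lt_top).ne
    hF.aestronglyMeasurable (ae_of_all _ hC)

lemma hasCompactSupport_of_norm_gt {F : Type*} [Zero F] {f : Euc n → F} {r : ℝ}
    (h0 : ∀ x, r < ‖x‖ → f x = 0) : HasCompactSupport f :=
  HasCompactSupport.intro (isCompact_closedBall 0 r) fun x hx => h0 x (by simpa using hx)

lemma integrable_of_continuous {F : Euc n → ℝ} {r : ℝ} (hF : Continuous F)
    (h0 : ∀ x, r < ‖x‖ → F x = 0) : Integrable F :=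
  hF.integrable_of_hasCompactSupport (hasCompactSupport_of_norm_gt h0)

/-- Dominated convergence for integrands that are uniformly bounded and supported in a fixed
ball. -/
lemma tendsto_integral_of_bound {F : ℝ → Euc n → ℝ} {G : Euc n → ℝ} {C r : ℝ}
    (hF : ∀ h, Measurable (F h)) (hC : ∀ᶠ h in 𝓝[>] (0 : ℝ), ∀ x, ‖x‖ ≤ r → ‖F h x‖ ≤ C)
    (h0 : ∀ h x, r < ‖x‖ → F h x = 0)
    (hlim : ∀ x, Tendsto (fun h => F h x) (𝓝[>] 0) (𝓝 (G x))) :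
    Tendsto (fun h => ∫ x, F h x) (𝓝[>] 0) (𝓝 (∫ x, G x)) := by
  refine tendsto_integral_filter_of_dominated_convergence
    ((closedBall (0 : Euc n) r).indicator fun _ => C)
    (Eventually.of_forall fun h => (hF h).aestronglyMeasurable) ?_ ?_
    (ae_of_all _ fun x => hlim x)
  · filter_upwards [hC] with h hh
    refine ae_of_all _ fun x => ?_
    by_cases hx : ‖x‖ ≤ r
    · rw [indicator_of_mem (by simpa using hx)]
      exact hh x hx
    · rw [indicator_of_notMem (by simpa using hx), h0 h x (not_le.1 hx), norm_zero]
  · rw [integrable_indicator_iff measurableSet_closedBall]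
    exact integrableOn_const measure_closedBall_lt_top.ne

end Integrability

section WeakEquation

variable {n : ℕ}

/-- The weak form of `-Δ_p u = f(u)` in `ball 0 R`, for globally defined `C¹` functions. -/
def WeakSolution (p R : ℝ) (f : ℝ → ℝ) (u : Euc n → ℝ) : Prop :=
  ∀ ξ : Euc n → ℝ, ContDiff ℝ 1 ξ → ∀ r < R, (∀ x, r < ‖x‖ → ξ x = 0) →
    ∫ x, ⟪pFlux p (∇ u x), ∇ ξ x⟫ = ∫ x, f (u x) * ξ x

/-- Stability in `ball 0 R`, restricted to `C¹` test functions whose gradient vanishes at the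
critical points of `u`. -/
def WeakStable (p R : ℝ) (f : ℝ → ℝ) (u : Euc n → ℝ) : Prop :=
  ∀ ξ : Euc n → ℝ, ContDiff ℝ 1 ξ → ∀ r < R, (∀ x, r < ‖x‖ → ξ x = 0) →
    (∀ x, ∇ u x = 0 → ∇ ξ x = 0) →
    0 ≤ (∫ x, pQuad p (∇ u x) (∇ ξ x)) - ∫ x, deriv f (u x) * ξ x ^ 2

lemma integral_comp_smul_euc (F : Euc n → ℝ) {l : ℝ} (hl : 0 < l) :
    ∫ x, F (l • x) = l ^ (-(n : ℝ)) * ∫ x, F x := by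
  rw [Measure.integral_comp_smul_of_nonneg volume F l (hR := hl.le), finrank_euclideanSpace_fin,
    smul_eq_mul, Real.rpow_neg hl.le, Real.rpow_natCast]

/-- The equation satisfied by the dilated function. -/
lemma WeakSolution.dilate {p R : ℝ} {f : ℝ → ℝ} {u : Euc n → ℝ} (hw : WeakSolution p R f u)
    {l r : ℝ} (hl : 0 < l) (hr : l * r < R) {ξ : Euc n → ℝ} (hξ : ContDiff ℝ 1 ξ)
    (h0 : ∀ x, r < ‖x‖ → ξ x = 0) :
    ∫ x, ⟪pFlux p (l • ∇ u (l • x)), ∇ ξ x⟫ = l ^ p * ∫ x, f (u (l • x)) * ξ x := by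
  have hl0 : l ≠ 0 := hl.ne'
  set ξ' : Euc n → ℝ := fun y => ξ (l⁻¹ • y) with hξ'
  have hval : ∀ x, ξ' (l • x) = ξ x := fun x => by simp only [hξ', inv_smul_smul₀ hl0]
  have hgrad : ∀ x, ∇ ξ' (l • x) = l⁻¹ • ∇ ξ x := fun x => by
    rw [((hξ.hasGradientAt (l⁻¹ • l • x)).comp_smul l⁻¹).gradient, inv_smul_smul₀ hl0]
  have key := hw ξ' (hξ.comp (contDiff_const_smul l⁻¹)) (l * r) hr fun y hy => by
    refine h0 _ ?_
    rw [norm_smul, norm_inv, Real.norm_eq_abs, abs_of_pos hl, inv_mul_eq_div, lt_div_iff₀ hl]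
    linarith
  have e1 := integral_comp_smul_euc (fun y => ⟪pFlux p (∇ u y), ∇ ξ' y⟫) hl
  have e2 := integral_comp_smul_euc (fun y => f (u y) * ξ' y) hl
  simp only [hval, hgrad, real_inner_smul_right, integral_const_mul] at e1 e2
  simp only [pFlux_smul hl, real_inner_smul_left, integral_const_mul]
  have hpow : l ^ p = l ^ (p - 1) * l := by
    nth_rewrite 3 [← Real.rpow_one l]
    rw [← Real.rpow_add hl]
    congr 1; ring
  rw [e2, ← key, ← e1, hpow]
  field_simp

end WeakEquation

section Ellipticity

variable {E : Type*} [NormedAddCommGroup E] [InnerProductSpace ℝ E]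

lemma pQuad_zero_right (p : ℝ) (a : E) : pQuad p a 0 = 0 := by simp [pQuad]

lemma pQuad_smul_right (p t : ℝ) (a v : E) : pQuad p a (t • v) = t ^ 2 * pQuad p a v := by
  simp only [pQuad, norm_smul, real_inner_smul_right, mul_pow, Real.norm_eq_abs, sq_abs]
  ring

lemma abs_pQuad_le (p : ℝ) (a v : E) :
    |pQuad p a v| ≤ (1 + |p - 2|) * ‖a‖ ^ (p - 2) * ‖v‖ ^ 2 := by
  rw [← inner_pLin_self]
  refine (abs_real_inner_le_norm _ _).trans ?_
  nlinarith [mul_le_mul_of_nonneg_right (norm_pLin_apply_le p a v) (norm_nonneg v)]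

lemma exists_rpow_bounds (q : ℝ) {d : ℝ} (M : ℝ) (hd : 0 < d) :
    ∃ k K : ℝ, 0 < k ∧ k ≤ K ∧ ∀ t, d ≤ t → t ≤ M → k ≤ t ^ q ∧ t ^ q ≤ K := by
  have hM : 0 < max d M := lt_max_of_lt_left hd
  refine ⟨min (d ^ q) ((max d M) ^ q), max (d ^ q) ((max d M) ^ q),
    lt_min (Real.rpow_pos_of_pos hd _) (Real.rpow_pos_of_pos hM _),
    (min_le_left _ _).trans (le_max_left _ _), fun t h1 h2 => ?_⟩
  have ht : 0 < t := hd.trans_le h1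
  have h2' : t ≤ max d M := h2.trans (le_max_right _ _)
  rcases le_total 0 q with hq | hq
  · exact ⟨(min_le_left _ _).trans (Real.rpow_le_rpow hd.le h1 hq),
      (Real.rpow_le_rpow ht.le h2' hq).trans (le_max_right _ _)⟩
  · exact ⟨(min_le_right _ _).trans (Real.rpow_le_rpow_of_nonpos ht h2' hq),
      (Real.rpow_le_rpow_of_nonpos hd h1 hq).trans (le_max_left _ _)⟩

/-- Away from its zero set, the linearised operator is uniformly elliptic. -/
lemma exists_ellipticity {p : ℝ} (hp : 1 < p) {d : ℝ} (M : ℝ) (hd : 0 < d) :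
    ∃ k K : ℝ, 0 < k ∧ k ≤ K ∧ ∀ a : E, d ≤ ‖a‖ → ‖a‖ ≤ M → ∀ v : E,
      k * ‖v‖ ^ 2 ≤ pQuad p a v ∧ ‖pLin p a v‖ ≤ K * ‖v‖ ∧ |pQuad p a v| ≤ K * ‖v‖ ^ 2 := by
  obtain ⟨k, K, hk, hkK, H⟩ := exists_rpow_bounds (p - 2) M hd
  have hm : 0 < min 1 (p - 1) := lt_min one_pos (by linarith)
  have hm1 : min 1 (p - 1) ≤ 1 := min_le_left _ _
  have hK : 0 < K := hk.trans_le hkK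
  refine ⟨min 1 (p - 1) * k, (1 + |p - 2|) * K, mul_pos hm hk, ?_, fun a h1 h2 v => ⟨?_, ?_, ?_⟩⟩
  · calc min 1 (p - 1) * k ≤ 1 * K := by gcongr
      _ ≤ (1 + |p - 2|) * K := by gcongr; linarith [abs_nonneg (p - 2)]
  · refine le_trans ?_ (le_pQuad p a v)
    rw [mul_assoc]
    have := (H _ h1 h2).1
    gcongr
  · refine (norm_pLin_apply_le p a v).trans ?_
    have := (H _ h1 h2).2
    gcongr
  · refine (abs_pQuad_le p a v).trans ?_
    have := (H _ h1 h2).2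
    gcongr

end Ellipticity

section Stability

variable {n : ℕ}

lemma measurable_pQuad (p : ℝ) {A B : Euc n → Euc n} (hA : Continuous A) (hB : Continuous B) :
    Measurable fun x => pQuad p (A x) (B x) := by
  have h1 := hA.norm.measurable
  have h2 := hB.norm.measurable
  have h3 : Measurable fun x => ⟪A x, B x⟫ := (hA.inner hB).measurable
  exact ((h1.pow_const _).mul (h2.pow_const 2)).add
    ((measurable_const.mul (h1.pow_const _)).mul (h3.pow_const 2))

lemma integrable_pQuad {p : ℝ} (hp : 1 < p) {A B : Euc n → Euc n} (hA : Continuous A)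
    (hB : Continuous B) {r d M : ℝ} (hd : 0 < d) (h0 : ∀ x, r < ‖x‖ → B x = 0)
    (hne : ∀ x, B x ≠ 0 → d ≤ ‖A x‖) (hM : ∀ x, ‖A x‖ ≤ M) :
    Integrable fun x => pQuad p (A x) (B x) := by
  obtain ⟨k, K, hk, hkK, H⟩ := exists_ellipticity (E := Euc n) hp M hd
  obtain ⟨L, hL⟩ := hB.bounded_above_of_compact_support (hasCompactSupport_of_norm_gt h0)
  refine integrable_of_bound (C := K * L ^ 2) (r := r) (measurable_pQuad p hA hB) (fun x => ?_)
    fun x hx => by simp only [h0 x hx, pQuad_zero_right]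
  have hK : 0 < K := hk.trans_le hkK
  by_cases hx : B x = 0
  · simp only [hx, pQuad_zero_right, norm_zero]; positivity
  · refine (H _ (hne x hx) (hM x) (B x)).2.2.trans ?_
    have := hL x
    gcongr

lemma norm_dilation_sub_le {G : Euc n → Euc n} {M : ℝ} (hM : ∀ x, ‖G x‖ ≤ M) {h : ℝ}
    (hh : 0 ≤ h) (x : Euc n) :
    ‖(1 + h) • G ((1 + h) • x) - G x‖ ≤ h * M + ‖G ((1 + h) • x) - G x‖ := by
  have : (1 + h) • G ((1 + h) • x) - G x
      = h • G ((1 + h) • x) + (G ((1 + h) • x) - G x) := by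
    rw [add_smul, one_smul]; abel
  rw [this]
  refine (norm_add_le _ _).trans ?_
  rw [norm_smul, Real.norm_eq_abs, abs_of_nonneg hh]
  gcongr
  exact hM _

/-- For small dilations, gradients are uniformly close, and a large difference quotient forces the
gradient to be nonzero. -/
lemma eventually_dilation_close {u : Euc n → ℝ} (hu : ContDiff ℝ 1 u)
    (huc : HasCompactSupport u) {e s : ℝ} (he : 0 < e) (hs : 0 < s) :
    ∀ᶠ h in 𝓝[>] (0 : ℝ), ∀ x : Euc n, ‖x‖ ≤ 1 →
      ‖(1 + h) • ∇ u ((1 + h) • x) - ∇ u x‖ < s ∧ (e < |dilQuot u h x| → e / 2 ≤ ‖∇ u x‖) := by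
  obtain ⟨M, hM⟩ := hu.continuous_gradient.bounded_above_of_compact_support huc.gradient
  have hM0 : 0 ≤ M := (norm_nonneg _).trans (hM 0)
  have huc' := huc.gradient.uniformContinuous_of_continuous hu.continuous_gradient
  rw [Metric.uniformContinuous_iff] at huc'
  obtain ⟨d, hd, H⟩ := huc' (min (s / 2) (e / 2)) (by positivity)
  have hI : Ioo 0 (min d (s / 2 / (M + 1))) ∈ 𝓝[>] (0 : ℝ) :=
    Ioo_mem_nhdsGT (by positivity)
  filter_upwards [hI] with h hh x hx
  have hh1 : h < d := hh.2.trans_le (min_le_left _ _)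
  have hh2 : h * M < s / 2 := by
    have := hh.2.trans_le (min_le_right _ _)
    rw [lt_div_iff₀ (by positivity)] at this
    nlinarith [hh.1]
  have hclose : ∀ t, 0 < t → t ≤ h → ‖∇ u ((1 + t) • x) - ∇ u x‖ < min (s / 2) (e / 2) := by
    intro t ht hth
    rw [← dist_eq_norm]
    refine H ?_
    rw [dist_eq_norm, add_smul, one_smul, add_sub_cancel_left, norm_smul, Real.norm_eq_abs,
      abs_of_pos ht]
    nlinarith [norm_nonneg x]
  constructor
  · have := (hclose h hh.1 le_rfl).trans_le (min_le_left _ _)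
    linarith [norm_dilation_sub_le hM hh.1.le x]
  · intro hc
    obtain ⟨t, ht, hte⟩ := exists_dilQuot_eq hu hh.1 x
    have h1 := (hclose t ht.1 ht.2.le).trans_le (min_le_right _ _)
    have h2 : |dilQuot u h x| ≤ ‖∇ u ((1 + t) • x)‖ := by
      rw [hte]
      refine (abs_real_inner_le_norm _ _).trans ?_
      nlinarith [norm_nonneg (∇ u ((1 + t) • x))]
    have h3 := norm_sub_norm_le (∇ u ((1 + t) • x)) (∇ u x)
    linarith

/-- The difference quotient of the right-hand side of the equation along dilations. -/
def rhsQuot (p : ℝ) (f : ℝ → ℝ) (u : Euc n → ℝ) (h : ℝ) (x : Euc n) : ℝ :=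
  ((1 + h) ^ p * f (u ((1 + h) • x)) - f (u x)) / h

lemma continuous_rhsQuot (p : ℝ) {f : ℝ → ℝ} {u : Euc n → ℝ} (hf : Continuous f)
    (hu : Continuous u) (h : ℝ) : Continuous (rhsQuot p f u h) := by
  have h1 : Continuous fun x : Euc n => f (u ((1 + h) • x)) :=
    hf.comp (hu.comp (continuous_const_smul _))
  exact ((h1.const_mul _).sub (hf.comp hu)).div_const h

lemma WeakSolution.difference_quotient {p R : ℝ} (hp : 1 < p) {f : ℝ → ℝ} {u : Euc n → ℝ}
    (hw : WeakSolution p R f u) (hf : Continuous f) (hu : ContDiff ℝ 1 u)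
    {h r : ℝ} (hh : 0 < h) (hr : (1 + h) * r < R) (hrR : r < R) {ξ : Euc n → ℝ}
    (hξ : ContDiff ℝ 1 ξ) (h0 : ∀ x, r < ‖x‖ → ξ x = 0) :
    ∫ x, ⟪h⁻¹ • (pFlux p ((1 + h) • ∇ u ((1 + h) • x)) - pFlux p (∇ u x)), ∇ ξ x⟫
      = ∫ x, rhsQuot p f u h x * ξ x := by
  have h1 := hw.dilate (by linarith : 0 < 1 + h) hr hξ h0
  have h2 := hw ξ hξ r hrR h0
  have hg0 : ∀ x, r < ‖x‖ → ∇ ξ x = 0 := fun x hx => gradient_eq_zero_of_norm_gt h0 hx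
  have hG := hu.continuous_gradient
  have hξg := hξ.continuous_gradient
  have hsm : Continuous fun x : Euc n => (1 + h) • x := continuous_const_smul _
  have hV := continuous_pFlux (E := Euc n) hp
  have c0 : Continuous fun x : Euc n => ∇ u ((1 + h) • x) := hG.comp hsm
  have c1 : Continuous fun x => pFlux p ((1 + h) • ∇ u ((1 + h) • x)) :=
    hV.comp ((continuous_const_smul (1 + h)).comp c0)
  have c2 : Continuous fun x => pFlux p (∇ u x) := hV.comp hG
  have c3 : Continuous fun x => f (u ((1 + h) • x)) := hf.comp (hu.continuous.comp hsm)
  have c4 : Continuous fun x => f (u x) := hf.comp hu.continuous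
  have i1 : Integrable fun x => ⟪pFlux p ((1 + h) • ∇ u ((1 + h) • x)), ∇ ξ x⟫ :=
    integrable_of_continuous (c1.inner hξg) fun x hx => by rw [hg0 x hx, inner_zero_right]
  have i2 : Integrable fun x => ⟪pFlux p (∇ u x), ∇ ξ x⟫ :=
    integrable_of_continuous (c2.inner hξg) fun x hx => by rw [hg0 x hx, inner_zero_right]
  have i3 : Integrable fun x => f (u ((1 + h) • x)) * ξ x :=
    integrable_of_continuous (c3.mul hξ.continuous) fun x hx => by rw [h0 x hx, mul_zero]
  have i4 : Integrable fun x => f (u x) * ξ x :=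
    integrable_of_continuous (c4.mul hξ.continuous) fun x hx => by rw [h0 x hx, mul_zero]
  have e1 : ∀ x, ⟪h⁻¹ • (pFlux p ((1 + h) • ∇ u ((1 + h) • x)) - pFlux p (∇ u x)), ∇ ξ x⟫
      = h⁻¹ * (⟪pFlux p ((1 + h) • ∇ u ((1 + h) • x)), ∇ ξ x⟫ - ⟪pFlux p (∇ u x), ∇ ξ x⟫) :=
    fun x => by rw [real_inner_smul_left, inner_sub_left]
  have e2 : ∀ x, rhsQuot p f u h x * ξ x
      = h⁻¹ * ((1 + h) ^ p * (f (u ((1 + h) • x)) * ξ x) - f (u x) * ξ x) := fun x => by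
    rw [rhsQuot, div_eq_inv_mul]; ring
  rw [integral_congr_ae (ae_of_all _ e1), integral_congr_ae (ae_of_all _ e2), integral_const_mul,
    integral_const_mul, integral_sub i1 i2, integral_sub (i3.const_mul _) i4, integral_const_mul,
    h1, h2]

end Stability

section DiscreteStability

variable {n : ℕ}

/-- The integrand bounding the second variation from above, for a test function built from the
function `c` (a difference quotient of `u` or its limit). -/
def stabIntegrand (p C m e : ℝ) (η : Euc n → ℝ) (G : Euc n → Euc n) (c Q F : Euc n → ℝ)
    (x : Euc n) : ℝ :=
  truncFun e (c x) ^ 2 * pQuad p (G x) (∇ η x) + C * m * (truncFun e (c x) ^ 2 * ‖∇ η x‖ ^ 2)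
    + (1 + m) * (Q x * (truncFun e (c x) * cutoffFun e (c x) * η x ^ 2))
    - F x * (truncFun e (c x) * η x) ^ 2

lemma hasGradientAt_truncFun_mul {c η : Euc n → ℝ} {g x : Euc n} (e : ℝ)
    (hc : HasGradientAt c g x) (hη : ContDiff ℝ 1 η) :
    HasGradientAt (fun y => truncFun e (c y) * η y)
      ((cutoffFun e (c x) * η x) • g + truncFun e (c x) • ∇ η x) x := by
  have h := ((hasDerivAt_truncFun e (c x)).comp_hasGradientAt hc).mul (hη.hasGradientAt x)
  convert h using 1
  simp only [smul_smul, mul_comm]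
  abel

lemma hasGradientAt_truncFun_mul_cutoffFun_mul_sq {c η : Euc n → ℝ} {g x : Euc n} (e : ℝ)
    (hc : HasGradientAt c g x) (hη : ContDiff ℝ 1 η) :
    HasGradientAt (fun y => truncFun e (c y) * cutoffFun e (c y) * η y ^ 2)
      (((cutoffFun e (c x) * η x) ^ 2
          + truncFun e (c x) * deriv (cutoffFun e) (c x) * η x ^ 2) • g
        + (2 * (cutoffFun e (c x) * η x * truncFun e (c x))) • ∇ η x) x := by
  have h1 := ((hasDerivAt_truncFun e (c x)).comp_hasGradientAt hc).mul
    ((hasDerivAt_cutoffFun e (c x)).comp_hasGradientAt hc)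
  have h2 := (hη.hasGradientAt x).mul (hη.hasGradientAt x)
  have h := h1.mul h2
  convert h using 1
  · funext y; ring
  · module

lemma norm_inv_smul_flux_sub_le {p w s d M : ℝ}
    (H : ∀ a b : Euc n, d ≤ ‖a‖ → ‖a‖ ≤ M → ‖b - a‖ < s →
      ‖pFlux p b - pFlux p a - pLin p a (b - a)‖ ≤ w * ‖b - a‖) {h : ℝ}
    {a b : Euc n} (h1 : d ≤ ‖a‖) (h2 : ‖a‖ ≤ M) (h3 : ‖b - a‖ < s) :
    ‖h⁻¹ • (pFlux p b - pFlux p a) - pLin p a (h⁻¹ • (b - a))‖ ≤ w * ‖h⁻¹ • (b - a)‖ := by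
  rw [map_smul, ← smul_sub, norm_smul, norm_smul]
  have := H a b h1 h2 h3
  calc _ ≤ ‖h⁻¹‖ * (w * ‖b - a‖) := by gcongr
    _ = _ := by ring

/-- The discrete stability inequality, tested along dilations. -/
lemma WeakStable.eventually_integral_nonneg {p R r : ℝ} (hp : 1 < p) {f : ℝ → ℝ}
    {u : Euc n → ℝ} (hst : WeakStable p R f u) (hw : WeakSolution p R f u)
    (hf : ContDiff ℝ 1 f) (hu : ContDiff ℝ 1 u) (huc : HasCompactSupport u) (hrR : r < R)
    (hR : R ≤ 1) {η : Euc n → ℝ} (hη : ContDiff ℝ 1 η) (h0 : ∀ x, r < ‖x‖ → η x = 0)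
    {e : ℝ} (he : 0 < e) :
    ∃ C : ℝ, ∀ m, 0 < m → m ≤ 1 → ∀ᶠ h in 𝓝[>] (0 : ℝ),
      0 ≤ ∫ x, stabIntegrand p C m e η (∇ u) (dilQuot u h) (rhsQuot p f u h)
        (fun x => deriv f (u x)) x := by
  obtain ⟨M, hM⟩ := hu.continuous_gradient.bounded_above_of_compact_support huc.gradient
  obtain ⟨k, K, hk, hkK, hell⟩ := exists_ellipticity (E := Euc n) hp M (half_pos he)
  refine ⟨5 * K ^ 2 / k, fun m hm hm1 => ?_⟩
  have hwp : 0 < m * k / 4 := by positivity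
  obtain ⟨s, hs, Hs⟩ := exists_norm_pFlux_sub_sub_le (E := Euc n) p (M := M) (half_pos he) hwp
  have hI : ∀ᶠ h in 𝓝[>] (0 : ℝ), (1 + h) * r < R := by
    have : Tendsto (fun h : ℝ => (1 + h) * r) (𝓝[>] 0) (𝓝 ((1 + 0) * r)) :=
      Tendsto.mono_left (Continuous.tendsto (by fun_prop) 0) nhdsWithin_le_nhds
    exact this.eventually_lt_const (by simpa using hrR)
  filter_upwards [hI, self_mem_nhdsWithin, eventually_dilation_close hu huc he hs]
    with h hhr hh hclose
  have hh : 0 < h := hh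
  set G := ∇ u with hGdef
  set c := dilQuot u h with hcdef
  have hG : Continuous G := hu.continuous_gradient
  have hc : ContDiff ℝ 1 c := contDiff_dilQuot hu h
  have hT : ContDiff ℝ 1 fun x => truncFun e (c x) := (contDiff_truncFun e).comp hc
  have hθ : ContDiff ℝ 1 fun x => cutoffFun e (c x) := (contDiff_cutoffFun e).comp hc
  set ξ₁ : Euc n → ℝ := fun x => truncFun e (c x) * η x with hξ₁
  set ξ₂ : Euc n → ℝ := fun x => truncFun e (c x) * cutoffFun e (c x) * η x ^ 2 with hξ₂
  have cξ₁ : ContDiff ℝ 1 ξ₁ := hT.mul hη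
  have cξ₂ : ContDiff ℝ 1 ξ₂ := (hT.mul hθ).mul (hη.pow 2)
  have zξ₁ : ∀ x, r < ‖x‖ → ξ₁ x = 0 := fun x hx => by simp only [hξ₁, h0 x hx, mul_zero]
  have zξ₂ : ∀ x, r < ‖x‖ → ξ₂ x = 0 := fun x hx => by
    simp only [hξ₂, h0 x hx]; ring
  have zη : ∀ x, r < ‖x‖ → ∇ η x = 0 := fun x hx => gradient_eq_zero_of_norm_gt h0 hx
  have g₁ : ∀ x, ∇ ξ₁ x = (cutoffFun e (c x) * η x) • dilQuotGrad u h x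
      + truncFun e (c x) • ∇ η x := fun x =>
    (hasGradientAt_truncFun_mul e (hasGradientAt_dilQuot hu h x) hη).gradient
  have g₂ : ∀ x, ∇ ξ₂ x = ((cutoffFun e (c x) * η x) ^ 2
          + truncFun e (c x) * deriv (cutoffFun e) (c x) * η x ^ 2) • dilQuotGrad u h x
        + (2 * (cutoffFun e (c x) * η x * truncFun e (c x))) • ∇ η x := fun x =>
    (hasGradientAt_truncFun_mul_cutoffFun_mul_sq e (hasGradientAt_dilQuot hu h x) hη).gradient
  have hdich : ∀ x, (r < ‖x‖ ∨ |c x| ≤ e) ∨ (e / 2 ≤ ‖G x‖ ∧ e < |c x| ∧ ‖x‖ ≤ 1) := fun x => by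
    by_cases h1 : r < ‖x‖
    · exact Or.inl (Or.inl h1)
    by_cases h2 : |c x| ≤ e
    · exact Or.inl (Or.inr h2)
    have hx1 : ‖x‖ ≤ 1 := by linarith
    exact Or.inr ⟨(hclose x hx1).2 (not_le.1 h2), not_le.1 h2, hx1⟩
  have z₁ : ∀ x, (r < ‖x‖ ∨ |c x| ≤ e) → truncFun e (c x) • ∇ η x = 0 ∧ ∇ ξ₁ x = 0 ∧
      ∇ ξ₂ x = 0 := by
    rintro x (hx | hx)
    · simp [g₁, g₂, h0 x hx, zη x hx]
    · simp [g₁, g₂, truncFun_eq_zero he hx, cutoffFun_eq_zero he hx]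
  have nsq : ∀ (t : ℝ) (v : Euc n), ‖t • v‖ ^ 2 = t ^ 2 * ‖v‖ ^ 2 := fun t v => by
    rw [norm_smul, mul_pow, Real.norm_eq_abs, sq_abs]
  have key : ∀ x, pQuad p (G x) (∇ ξ₁ x)
      - (1 + m) * ⟪h⁻¹ • (pFlux p ((1 + h) • G ((1 + h) • x)) - pFlux p (G x)), ∇ ξ₂ x⟫
      ≤ pQuad p (G x) (truncFun e (c x) • ∇ η x)
        + 5 * K ^ 2 / k * m * ‖truncFun e (c x) • ∇ η x‖ ^ 2 := by
    intro x
    rcases hdich x with hx | ⟨hx1, hx2, hx3⟩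
    · simp [z₁ x hx, pQuad_zero_right]
    · rw [g₁, g₂, pQuad_smul_right, nsq]
      refine stability_pointwise hk hkK hm hm1 le_rfl (fun v => (hell _ hx1 (hM x) v).1)
        (fun v => (hell _ hx1 (hM x) v).2.1)
        (norm_inv_smul_flux_sub_le Hs hx1 (hM x) (hclose x hx3).1) ?_
      exact mul_nonneg (truncFun_mul_deriv_cutoffFun_nonneg e _) (sq_nonneg _)
  have cTη : Continuous fun x => truncFun e (c x) • ∇ η x :=
    hT.continuous.smul hη.continuous_gradient
  have i₁ : Integrable fun x => pQuad p (G x) (∇ ξ₁ x) := by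
    refine integrable_pQuad (r := r) hp hG cξ₁.continuous_gradient (half_pos he)
      (fun x hx => (z₁ x (Or.inl hx)).2.1) (fun x hx => ?_) hM
    exact ((hdich x).resolve_left fun h => hx (z₁ x h).2.1).1
  have i₅ : Integrable fun x => pQuad p (G x) (truncFun e (c x) • ∇ η x) := by
    refine integrable_pQuad (r := r) hp hG cTη (half_pos he)
      (fun x hx => (z₁ x (Or.inl hx)).1) (fun x hx => ?_) hM
    exact ((hdich x).resolve_left fun h => hx (z₁ x h).1).1
  have i₆ : Integrable fun x => ‖truncFun e (c x) • ∇ η x‖ ^ 2 :=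
    integrable_of_continuous (r := r) (cTη.norm.pow 2) fun x hx => by
      rw [(z₁ x (Or.inl hx)).1, norm_zero]; ring
  have i₂ : Integrable fun x => deriv f (u x) * ξ₁ x ^ 2 :=
    integrable_of_continuous (r := r)
      (((hf.continuous_deriv le_rfl).comp hu.continuous).mul (cξ₁.continuous.pow 2))
      fun x hx => by simp [zξ₁ x hx]
  have i₄ : Integrable fun x => rhsQuot p f u h x * ξ₂ x :=
    integrable_of_continuous (r := r)
      ((continuous_rhsQuot p hf.continuous hu.continuous h).mul cξ₂.continuous)
      fun x hx => by simp [zξ₂ x hx]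
  have c0 : Continuous fun x : Euc n => G ((1 + h) • x) := hG.comp (continuous_const_smul _)
  have hV := continuous_pFlux (E := Euc n) hp
  have c1 : Continuous fun x => pFlux p ((1 + h) • G ((1 + h) • x)) :=
    hV.comp ((continuous_const_smul (1 + h)).comp c0)
  have c2 : Continuous fun x => pFlux p (G x) := hV.comp hG
  have c3 : Continuous fun x => h⁻¹ • (pFlux p ((1 + h) • G ((1 + h) • x)) - pFlux p (G x)) :=
    (continuous_const_smul h⁻¹).comp (c1.sub c2)
  have i₃ : Integrable fun x =>
      ⟪h⁻¹ • (pFlux p ((1 + h) • G ((1 + h) • x)) - pFlux p (G x)), ∇ ξ₂ x⟫ :=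
    integrable_of_continuous (r := r) (c3.inner cξ₂.continuous_gradient)
      fun x hx => by rw [(z₁ x (Or.inl hx)).2.2, inner_zero_right]
  have e1 := hst ξ₁ cξ₁ r hrR zξ₁ fun x hx => by
    refine (z₁ x ((hdich x).resolve_right ?_)).2.1
    rintro ⟨h1, -, -⟩
    rw [hGdef, hx, norm_zero] at h1
    linarith
  have e2 := hw.difference_quotient hp hf.continuous hu hh hhr hrR cξ₂ zξ₂
  have e3 : ∀ x, stabIntegrand p (5 * K ^ 2 / k) m e η G c (rhsQuot p f u h)
      (fun x => deriv f (u x)) x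
      = pQuad p (G x) (truncFun e (c x) • ∇ η x)
        + 5 * K ^ 2 / k * m * ‖truncFun e (c x) • ∇ η x‖ ^ 2
        + (1 + m) * (rhsQuot p f u h x * ξ₂ x) - deriv f (u x) * ξ₁ x ^ 2 := fun x => by
    rw [stabIntegrand, pQuad_smul_right, nsq]
  rw [integral_congr_ae (ae_of_all _ e3)]
  have i₇ : Integrable fun x => pQuad p (G x) (truncFun e (c x) • ∇ η x)
        + 5 * K ^ 2 / k * m * ‖truncFun e (c x) • ∇ η x‖ ^ 2 :=
    i₅.add (i₆.const_mul (5 * K ^ 2 / k * m))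
  have i₈ : Integrable fun x => pQuad p (G x) (∇ ξ₁ x) - (1 + m) *
      ⟪h⁻¹ • (pFlux p ((1 + h) • G ((1 + h) • x)) - pFlux p (G x)), ∇ ξ₂ x⟫ :=
    i₁.sub (i₃.const_mul (1 + m))
  have i₉ : Integrable fun x => pQuad p (G x) (truncFun e (c x) • ∇ η x)
        + 5 * K ^ 2 / k * m * ‖truncFun e (c x) • ∇ η x‖ ^ 2
        + (1 + m) * (rhsQuot p f u h x * ξ₂ x) :=
    i₇.add (i₄.const_mul (1 + m))
  have hle := integral_mono i₈ i₇ key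
  rw [integral_sub i₉ i₂, integral_add i₇ (i₄.const_mul _), integral_const_mul]
  rw [integral_sub i₁ (i₃.const_mul _), integral_const_mul, e2] at hle
  linarith

end DiscreteStability

section StabilityLimit

variable {n : ℕ}

lemma abs_stabIntegrand_le {p C m e A B D H L P : ℝ} {η : Euc n → ℝ} {G : Euc n → Euc n}
    {c Q F : Euc n → ℝ} {x : Euc n} (hm : 0 ≤ m) (hm1 : m ≤ 1)
    (hP : truncFun e (c x) ^ 2 * |pQuad p (G x) (∇ η x)| ≤ P) (hA : |c x| ≤ A) (hB : |Q x| ≤ B)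
    (hD : |F x| ≤ D) (hH : |η x| ≤ H) (hL : ‖∇ η x‖ ≤ L) :
    ‖stabIntegrand p C m e η G c Q F x‖
      ≤ P + |C| * 1 * (A ^ 2 * L ^ 2) + 2 * (B * (A * 1 * H ^ 2)) + D * (A * H) ^ 2 := by
  have hT : |truncFun e (c x)| ≤ A := (abs_truncFun_le e _).trans hA
  have hA0 : 0 ≤ A := (abs_nonneg _).trans hA
  have hB0 : 0 ≤ B := (abs_nonneg _).trans hB
  have hD0 : 0 ≤ D := (abs_nonneg _).trans hD
  have hH0 : 0 ≤ H := (abs_nonneg _).trans hH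
  have hθ : |cutoffFun e (c x)| ≤ 1 := by
    rw [abs_of_nonneg (cutoffFun_nonneg e _)]; exact cutoffFun_le_one e _
  have t1 : |truncFun e (c x) ^ 2 * pQuad p (G x) (∇ η x)| ≤ P := by
    rwa [abs_mul, abs_of_nonneg (sq_nonneg _)]
  have t2 : |C * m * (truncFun e (c x) ^ 2 * ‖∇ η x‖ ^ 2)| ≤ |C| * 1 * (A ^ 2 * L ^ 2) := by
    rw [abs_mul, abs_mul, abs_mul, abs_pow, abs_pow, abs_norm, abs_of_nonneg hm]
    gcongr
  have t3 : |(1 + m) * (Q x * (truncFun e (c x) * cutoffFun e (c x) * η x ^ 2))|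
      ≤ 2 * (B * (A * 1 * H ^ 2)) := by
    rw [abs_mul, abs_mul, abs_mul, abs_mul, abs_pow, abs_of_nonneg (by linarith : 0 ≤ 1 + m)]
    gcongr
    linarith
  have t4 : |F x * (truncFun e (c x) * η x) ^ 2| ≤ D * (A * H) ^ 2 := by
    rw [abs_mul, abs_pow, abs_mul]
    gcongr
  rw [stabIntegrand, Real.norm_eq_abs]
  refine (abs_sub _ _).trans (add_le_add ((abs_add_le _ _).trans (add_le_add
    ((abs_add_le _ _).trans (add_le_add t1 t2)) t3)) t4)

lemma measurable_stabIntegrand (p C m e : ℝ) {η : Euc n → ℝ} {G : Euc n → Euc n}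
    {c Q F : Euc n → ℝ} (hη : ContDiff ℝ 1 η) (hG : Continuous G) (hc : Continuous c)
    (hQ : Continuous Q) (hF : Continuous F) :
    Measurable (stabIntegrand p C m e η G c Q F) := by
  have hT : Continuous fun x => truncFun e (c x) := (contDiff_truncFun e).continuous.comp hc
  have hθ : Continuous fun x => cutoffFun e (c x) := (contDiff_cutoffFun e).continuous.comp hc
  have hη' := hη.continuous_gradient
  have h1 := measurable_pQuad p hG hη'
  have h2 : Continuous fun x => C * m * (truncFun e (c x) ^ 2 * ‖∇ η x‖ ^ 2) :=
    continuous_const.mul ((hT.pow 2).mul (hη'.norm.pow 2))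
  have h3 : Continuous fun x =>
      (1 + m) * (Q x * (truncFun e (c x) * cutoffFun e (c x) * η x ^ 2)) :=
    continuous_const.mul (hQ.mul ((hT.mul hθ).mul (hη.continuous.pow 2)))
  have h4 : Continuous fun x => F x * (truncFun e (c x) * η x) ^ 2 :=
    hF.mul ((hT.mul hη.continuous).pow 2)
  exact ((((hT.pow 2).measurable.mul h1).add h2.measurable).add h3.measurable).sub h4.measurable

lemma stabIntegrand_eq_zero (p C m e : ℝ) {η : Euc n → ℝ} (G : Euc n → Euc n)
    (c Q F : Euc n → ℝ) {r : ℝ} (h0 : ∀ x, r < ‖x‖ → η x = 0) {x : Euc n} (hx : r < ‖x‖) :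
    stabIntegrand p C m e η G c Q F x = 0 := by
  simp [stabIntegrand, h0 x hx, gradient_eq_zero_of_norm_gt h0 hx, pQuad_zero_right]

lemma exists_bound_closedBall {F : Type*} [NormedAddCommGroup F] {g : Euc n → F}
    (hg : Continuous g) (r : ℝ) : ∃ C, ∀ x, ‖x‖ ≤ r → ‖g x‖ ≤ C := by
  obtain ⟨C, hC⟩ := (isCompact_closedBall (0 : Euc n) r).exists_bound_of_continuousOn
    hg.continuousOn
  exact ⟨C, fun x hx => hC x (by simpa using hx)⟩

lemma exists_abs_dilQuot_le {v : Euc n → ℝ} (hv : ContDiff ℝ 1 v) :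
    ∃ A, ∀ h ∈ Ioo (0 : ℝ) 1, ∀ x : Euc n, ‖x‖ ≤ 1 → |dilQuot v h x| ≤ A := by
  obtain ⟨M, hM⟩ := exists_bound_closedBall hv.continuous_gradient 2
  refine ⟨M, fun h hh x hx => ?_⟩
  obtain ⟨t, ht, hte⟩ := exists_dilQuot_eq hv hh.1 x
  have h1 : ‖(1 + t) • x‖ ≤ 2 := by
    rw [norm_smul, Real.norm_eq_abs, abs_of_pos (by linarith [ht.1])]
    nlinarith [norm_nonneg x, ht.1, ht.2, hh.2]
  rw [hte]
  refine (abs_real_inner_le_norm _ _).trans ?_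
  nlinarith [norm_nonneg x, norm_nonneg (∇ v ((1 + t) • x)), hM _ h1]

lemma tendsto_one_add_rpow_sub_one_div (p : ℝ) :
    Tendsto (fun h : ℝ => ((1 + h) ^ p - 1) / h) (𝓝[>] 0) (𝓝 p) := by
  have h1 : HasDerivAt (fun t : ℝ => t ^ p) p 1 := by
    simpa using Real.hasDerivAt_rpow_const (p := p) (Or.inl (one_ne_zero (α := ℝ)))
  rw [hasDerivAt_iff_tendsto_slope_zero] at h1
  refine (h1.mono_left (nhdsWithin_mono _ fun y hy => ne_of_gt hy)).congr fun h => ?_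
  simp [div_eq_inv_mul]

lemma rhsQuot_eq (p : ℝ) (f : ℝ → ℝ) (u : Euc n → ℝ) (h : ℝ) (x : Euc n) :
    rhsQuot p f u h x
      = ((1 + h) ^ p - 1) / h * f (u ((1 + h) • x)) + dilQuot (fun y => f (u y)) h x := by
  simp only [rhsQuot, dilQuot]
  ring

lemma gradient_comp {f : ℝ → ℝ} {u : Euc n → ℝ} (hf : ContDiff ℝ 1 f) (hu : ContDiff ℝ 1 u)
    (x : Euc n) : ∇ (fun y => f (u y)) x = deriv f (u x) • ∇ u x :=
  (((hf.differentiable one_ne_zero).differentiableAt.hasDerivAt).comp_hasGradientAt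
    (hu.hasGradientAt x)).gradient

lemma exists_abs_rhsQuot_le (p : ℝ) {f : ℝ → ℝ} {u : Euc n → ℝ} (hf : ContDiff ℝ 1 f)
    (hu : ContDiff ℝ 1 u) :
    ∃ B, ∀ᶠ h in 𝓝[>] (0 : ℝ), ∀ x : Euc n, ‖x‖ ≤ 1 → |rhsQuot p f u h x| ≤ B := by
  obtain ⟨A, hA⟩ := exists_abs_dilQuot_le (hf.comp hu)
  obtain ⟨N, hN⟩ := exists_bound_closedBall (hf.continuous.comp hu.continuous) 2
  refine ⟨(|p| + 1) * N + A, ?_⟩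
  filter_upwards [(tendsto_one_add_rpow_sub_one_div p).abs.eventually_le_const
    (lt_add_one |p|), Ioo_mem_nhdsGT (zero_lt_one' ℝ)] with h h1 hh x hx
  have h2 : ‖(1 + h) • x‖ ≤ 2 := by
    rw [norm_smul, Real.norm_eq_abs, abs_of_pos (by linarith [hh.1])]
    nlinarith [norm_nonneg x, hh.1, hh.2]
  rw [rhsQuot_eq]
  refine (abs_add_le _ _).trans (add_le_add ?_ (hA h hh x hx))
  rw [abs_mul]
  exact mul_le_mul h1 (hN _ h2) (abs_nonneg _) (by positivity)

lemma tendsto_rhsQuot (p : ℝ) {f : ℝ → ℝ} {u : Euc n → ℝ} (hf : ContDiff ℝ 1 f)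
    (hu : ContDiff ℝ 1 u) (x : Euc n) :
    Tendsto (fun h => rhsQuot p f u h x) (𝓝[>] 0)
      (𝓝 (p * f (u x) + deriv f (u x) * ⟪x, ∇ u x⟫)) := by
  simp only [rhsQuot_eq]
  refine ((tendsto_one_add_rpow_sub_one_div p).mul ?_).add ?_
  · have : Continuous fun h : ℝ => f (u ((1 + h) • x)) :=
      hf.continuous.comp (hu.continuous.comp (by fun_prop))
    exact Tendsto.mono_left (by simpa using this.tendsto 0) nhdsWithin_le_nhds
  · have := tendsto_dilQuot (hf.comp hu) x
    rwa [show f ∘ u = fun y => f (u y) from rfl, gradient_comp hf hu,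
      real_inner_smul_right] at this

lemma norm_rpow_sub_two_mul_inner_sq_le {E : Type*} [NormedAddCommGroup E]
    [InnerProductSpace ℝ E] {p : ℝ} (hp : 1 < p) (x a : E) :
    ‖a‖ ^ (p - 2) * ⟪x, a⟫ ^ 2 ≤ ‖x‖ ^ 2 * ‖a‖ ^ p := by
  rcases eq_or_ne a 0 with rfl | ha
  · simp [Real.zero_rpow (by linarith : p ≠ 0)]
  have ha' : 0 < ‖a‖ := norm_pos_iff.2 ha
  have h1 : ‖a‖ ^ p = ‖a‖ ^ (p - 2) * ‖a‖ ^ 2 := by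
    rw [← Real.rpow_natCast, ← Real.rpow_add ha']; norm_num
  have h2 : ⟪x, a⟫ ^ 2 ≤ (‖x‖ * ‖a‖) ^ 2 :=
    sq_le_sq' (by linarith [neg_abs_le ⟪x, a⟫, abs_real_inner_le_norm x a])
      ((le_abs_self _).trans (abs_real_inner_le_norm x a))
  calc ‖a‖ ^ (p - 2) * ⟪x, a⟫ ^ 2 ≤ ‖a‖ ^ (p - 2) * (‖x‖ * ‖a‖) ^ 2 := by gcongr
    _ = _ := by rw [h1]; ring

lemma inner_sq_mul_abs_pQuad_le {E : Type*} [NormedAddCommGroup E] [InnerProductSpace ℝ E]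
    {p : ℝ} (hp : 1 < p) (x a v : E) :
    ⟪x, a⟫ ^ 2 * |pQuad p a v| ≤ (1 + |p - 2|) * (‖x‖ ^ 2 * ‖a‖ ^ p) * ‖v‖ ^ 2 := by
  calc ⟪x, a⟫ ^ 2 * |pQuad p a v|
      ≤ ⟪x, a⟫ ^ 2 * ((1 + |p - 2|) * ‖a‖ ^ (p - 2) * ‖v‖ ^ 2) := by
        gcongr; exact abs_pQuad_le p a v
    _ = (1 + |p - 2|) * (‖a‖ ^ (p - 2) * ⟪x, a⟫ ^ 2) * ‖v‖ ^ 2 := by ring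
    _ ≤ _ := by
        have := norm_rpow_sub_two_mul_inner_sq_le hp x a
        exact mul_le_mul_of_nonneg_right
          (mul_le_mul_of_nonneg_left this (by positivity)) (sq_nonneg _)

/-- The stability inequality tested with the radial field `⟪x, ∇ u x⟫` times a cutoff, after using
the linearised equation. -/
lemma WeakStable.integral_nonneg {p R r : ℝ} (hp : 1 < p) {f : ℝ → ℝ}
    {u : Euc n → ℝ} (hst : WeakStable p R f u) (hw : WeakSolution p R f u)
    (hf : ContDiff ℝ 1 f) (hu : ContDiff ℝ 1 u) (huc : HasCompactSupport u) (hrR : r < R)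
    (hR : R ≤ 1) {η : Euc n → ℝ} (hη : ContDiff ℝ 1 η) (h0 : ∀ x, r < ‖x‖ → η x = 0) :
    0 ≤ ∫ x, (⟪x, ∇ u x⟫ ^ 2 * pQuad p (∇ u x) (∇ η x)
      + p * (f (u x) * ⟪x, ∇ u x⟫ * η x ^ 2)) := by
  set G := ∇ u with hGdef
  have hG : Continuous G := hu.continuous_gradient
  set c : Euc n → ℝ := fun x => ⟪x, G x⟫ with hcdef
  have hc : Continuous c := continuous_id.inner hG
  set F : Euc n → ℝ := fun x => deriv f (u x) with hFdef
  have hF : Continuous F := (hf.continuous_deriv le_rfl).comp hu.continuous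
  set Q : Euc n → ℝ := fun x => p * f (u x) + F x * c x with hQdef
  have hfu : Continuous fun x => f (u x) := hf.continuous.comp hu.continuous
  have hQ : Continuous Q := (continuous_const.mul hfu).add (hF.mul hc)
  obtain ⟨M, hM⟩ := hG.bounded_above_of_compact_support huc.gradient
  obtain ⟨A, hA⟩ := exists_bound_closedBall hc 1
  obtain ⟨B, hB⟩ := exists_bound_closedBall hQ 1
  obtain ⟨D, hD⟩ := exists_bound_closedBall hF 1
  obtain ⟨H, hH⟩ := exists_bound_closedBall hη.continuous 1
  obtain ⟨L, hL⟩ := exists_bound_closedBall hη.continuous_gradient 1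
  obtain ⟨A', hA'⟩ := exists_abs_dilQuot_le hu
  obtain ⟨B', hB'⟩ := exists_abs_rhsQuot_le p hf hu
  have hr1 : r ≤ 1 := by linarith
  have hlim : ∀ e, 0 < e → ∃ C : ℝ, ∀ m, 0 < m → m ≤ 1 →
      0 ≤ ∫ x, stabIntegrand p C m e η G c Q F x := by
    intro e he
    obtain ⟨C, hC⟩ := hst.eventually_integral_nonneg hp hw hf hu huc hrR hR hη h0 he
    obtain ⟨k, K, hk, hkK, hell⟩ := exists_ellipticity (E := Euc n) hp M (half_pos he)
    refine ⟨C, fun m hm hm1 => ?_⟩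
    have hK : 0 < K := hk.trans_le hkK
    refine ge_of_tendsto (tendsto_integral_of_bound
      (F := fun h => stabIntegrand p C m e η G (dilQuot u h) (rhsQuot p f u h) F)
      (C := A' ^ 2 * (K * L ^ 2) + |C| * 1 * (A' ^ 2 * L ^ 2) + 2 * (B' * (A' * 1 * H ^ 2))
        + D * (A' * H) ^ 2) (r := r)
      (fun h => measurable_stabIntegrand p C m e hη hG (contDiff_dilQuot hu h).continuous
        (continuous_rhsQuot p hf.continuous hu.continuous h) hF) ?_
      (fun h x hx => stabIntegrand_eq_zero p C m e _ _ _ _ h0 hx) ?_) (hC m hm hm1)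
    · filter_upwards [hB', Ioo_mem_nhdsGT (zero_lt_one' ℝ),
        eventually_dilation_close hu huc he one_pos] with h h1 h2 h3 x hx
      have hx1 : ‖x‖ ≤ 1 := hx.trans hr1
      refine abs_stabIntegrand_le hm.le hm1 ?_ (hA' h h2 x hx1) (h1 x hx1) (hD x hx1)
        (hH x hx1) (hL x hx1)
      have hAx := hA' h h2 x hx1
      have hA0 : 0 ≤ A' := (abs_nonneg _).trans hAx
      by_cases hs : |dilQuot u h x| ≤ e
      · rw [truncFun_eq_zero he hs]
        have : (0 : ℝ) ≤ A' ^ 2 * (K * L ^ 2) := by positivity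
        simpa using this
      · have h4 := (hell (G x) ((h3 x hx1).2 (not_le.1 hs)) (hM x) (∇ η x)).2.2
        have h5 := hL x hx1
        have h6 : truncFun e (dilQuot u h x) ^ 2 ≤ A' ^ 2 := by
          rw [← sq_abs]
          have := (abs_truncFun_le e _).trans hAx
          gcongr
        calc _ ≤ A' ^ 2 * (K * ‖∇ η x‖ ^ 2) := by gcongr
          _ ≤ _ := by gcongr
    · intro x
      have h1 := tendsto_dilQuot hu x
      have h2 := ((contDiff_truncFun e).continuous.tendsto _).comp h1
      have h3 := ((contDiff_cutoffFun e).continuous.tendsto _).comp h1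
      have h4 := tendsto_rhsQuot p hf hu x
      exact ((((h2.pow 2).mul_const _).add (((h2.pow 2).mul_const _).const_mul _)).add
        ((h4.mul ((h2.mul h3).mul_const _)).const_mul _)).sub
        (((h2.mul_const _).pow 2).const_mul _)
  obtain ⟨P, hP⟩ : ∃ P, ∀ e x, ‖x‖ ≤ 1 →
      truncFun e (c x) ^ 2 * |pQuad p (G x) (∇ η x)| ≤ P := by
    refine ⟨(1 + |p - 2|) * (1 ^ 2 * M ^ p) * L ^ 2, fun e x hx => ?_⟩
    have h1 : truncFun e (c x) ^ 2 ≤ c x ^ 2 := sq_le_sq.2 (abs_truncFun_le e _)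
    have h2 := inner_sq_mul_abs_pQuad_le hp x (G x) (∇ η x)
    have h3 := hL x hx
    have hM0 : 0 ≤ M := (norm_nonneg _).trans (hM x)
    have h4 : ‖G x‖ ^ p ≤ M ^ p := Real.rpow_le_rpow (norm_nonneg _) (hM x) (by linarith)
    calc _ ≤ c x ^ 2 * |pQuad p (G x) (∇ η x)| := by gcongr
      _ ≤ _ := h2
      _ ≤ _ := by gcongr
  have hnonneg : ∀ e, 0 < e → 0 ≤ ∫ x, stabIntegrand p 0 0 e η G c Q F x := by
    intro e he
    obtain ⟨C, hC⟩ := hlim e he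
    refine ge_of_tendsto (tendsto_integral_of_bound
      (F := fun m => stabIntegrand p C m e η G c Q F)
      (C := P + |C| * 1 * (A ^ 2 * L ^ 2) + 2 * (B * (A * 1 * H ^ 2)) + D * (A * H) ^ 2) (r := r)
      (fun m => measurable_stabIntegrand p C m e hη hG hc hQ hF) ?_
      (fun m x hx => stabIntegrand_eq_zero p C m e _ _ _ _ h0 hx) ?_)
      (b := 0) ?_
    · filter_upwards [Ioo_mem_nhdsGT (zero_lt_one' ℝ)] with m hm x hx
      have hx1 : ‖x‖ ≤ 1 := hx.trans hr1
      exact abs_stabIntegrand_le hm.1.le hm.2.le (hP e x hx1) (hA x hx1) (hB x hx1) (hD x hx1)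
        (hH x hx1) (hL x hx1)
    · intro x
      have : Continuous fun m => stabIntegrand p C m e η G c Q F x := by
        unfold stabIntegrand; fun_prop
      have h := (this.tendsto 0).mono_left (nhdsWithin_le_nhds (s := Ioi 0))
      convert h using 2
      simp [stabIntegrand]
    · filter_upwards [Ioo_mem_nhdsGT (zero_lt_one' ℝ)] with m hm
      exact hC m hm.1 hm.2.le
  refine ge_of_tendsto (tendsto_integral_of_bound
    (F := fun e => stabIntegrand p 0 0 e η G c Q F)
    (C := P + |0| * 1 * (A ^ 2 * L ^ 2) + 2 * (B * (A * 1 * H ^ 2)) + D * (A * H) ^ 2) (r := r)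
    (fun e => measurable_stabIntegrand p 0 0 e hη hG hc hQ hF) ?_
    (fun e x hx => stabIntegrand_eq_zero p 0 0 e _ _ _ _ h0 hx) ?_)
    (b := 0) ?_
  · filter_upwards with e x hx
    have hx1 : ‖x‖ ≤ 1 := hx.trans hr1
    exact abs_stabIntegrand_le le_rfl zero_le_one (hP e x hx1) (hA x hx1) (hB x hx1) (hD x hx1)
      (hH x hx1) (hL x hx1)
  · intro x
    have h2 := tendsto_truncFun (c x)
    have h3 : Tendsto (fun e => truncFun e (c x) * cutoffFun e (c x)) (𝓝[>] 0) (𝓝 (c x)) := by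
      rcases eq_or_ne (c x) 0 with h | h
      · simp [h, truncFun]
      · simpa using h2.mul (tendsto_cutoffFun h)
    have h4 := ((((h2.pow 2).mul_const (pQuad p (G x) (∇ η x))).add
      (((h2.pow 2).mul_const (‖∇ η x‖ ^ 2)).const_mul (0 * 0))).add
      (((h3.mul_const (η x ^ 2)).const_mul (Q x)).const_mul (1 + 0))).sub
      (((h2.mul_const (η x)).pow 2).const_mul (F x))
    refine h4.congr' (Eventually.of_forall fun e => rfl) |>.trans (le_of_eq ?_)
    congr 1
    simp only [hQdef, hcdef]
    ring
  · filter_upwards [self_mem_nhdsWithin] with e he using hnonneg e he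

end StabilityLimit

section Pohozaev

variable {n : ℕ}

lemma tendsto_dilQuot_inv_smul {v : Euc n → ℝ} (hv : ContDiff ℝ 1 v) (y : Euc n) :
    Tendsto (fun h => dilQuot v h ((1 + h)⁻¹ • y)) (𝓝[>] 0) (𝓝 ⟪y, ∇ v y⟫) := by
  have h1 : HasDerivAt (fun s : ℝ => (1 + s)⁻¹ - 1) (-1) 0 := by
    have := (((hasDerivAt_id (0 : ℝ)).const_add 1).inv (by simp)).sub_const 1
    simpa using this
  have h2 := hasDerivAt_comp_one_add_smul hv ((1 + (0 : ℝ))⁻¹ - 1) y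
  have h3 := h2.comp (0 : ℝ) h1
  rw [hasDerivAt_iff_tendsto_slope_zero] at h3
  have h4 := (h3.mono_left (nhdsWithin_mono _ fun y hy => ne_of_gt hy :
    𝓝[>] (0 : ℝ) ≤ 𝓝[≠] 0)).neg
  simp only [Function.comp_def, zero_add, add_zero, add_sub_cancel, inv_one, one_smul, sub_self,
    smul_eq_mul, mul_neg, mul_one, neg_neg] at h4
  refine h4.congr' ?_
  filter_upwards [self_mem_nhdsWithin] with h (hh : 0 < h)
  rw [dilQuot, smul_inv_smul₀ (by linarith : 1 + h ≠ 0), div_eq_inv_mul]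
  ring

/-- The Pohozaev-type inequality obtained by testing the equation with dilation difference
quotients and using convexity of `‖·‖ ^ p`. -/
lemma WeakSolution.pohozaev_le {p R r : ℝ} (hp : 1 < p) {f : ℝ → ℝ} {u : Euc n → ℝ}
    (hw : WeakSolution p R f u) (hf : Continuous f) (hu : ContDiff ℝ 1 u)
    (huc : HasCompactSupport u) (hrR : r < R) (hR : R ≤ 1) {v : Euc n → ℝ}
    (hv : ContDiff ℝ 1 v) (hv0 : ∀ x, 0 ≤ v x) (h0 : ∀ x, r < ‖x‖ → v x = 0) :
    p * ∫ x, f (u x) * (⟪x, ∇ u x⟫ * v x)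
      ≤ (∫ x, ((p - n) * v x - ⟪x, ∇ v x⟫) * ‖∇ u x‖ ^ p)
        + p * ∫ x, ⟪x, ∇ u x⟫ * ⟪pFlux p (∇ u x), ∇ v x⟫ := by
  set G := ∇ u with hGdef
  have hG : Continuous G := hu.continuous_gradient
  have hr1 : r ≤ 1 := by linarith
  have hV : Continuous fun x => pFlux p (G x) := (continuous_pFlux (E := Euc n) hp).comp hG
  have hfu : Continuous fun x => f (u x) := hf.comp hu.continuous
  have hW : Continuous fun x => ‖G x‖ ^ p :=
    hG.norm.rpow_const fun x => Or.inr (by linarith)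
  have hvg := hv.continuous_gradient
  have zvg : ∀ x, r < ‖x‖ → ∇ v x = 0 := fun x hx => gradient_eq_zero_of_norm_gt h0 hx
  obtain ⟨r₀, hr₀⟩ : ∃ r₀, ∀ x, r₀ < ‖x‖ → G x = 0 := by
    obtain ⟨r₀, h⟩ := huc.gradient.isCompact.isBounded.subset_closedBall (0 : Euc n)
    refine ⟨r₀, fun x hx => ?_⟩
    by_contra hc
    have := h (subset_tsupport _ hc)
    rw [mem_closedBall_zero_iff] at this
    linarith
  have hW0 : ∀ x, r₀ < ‖x‖ → ‖G x‖ ^ p = 0 := fun x hx => by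
    rw [hr₀ x hx, norm_zero, Real.zero_rpow (by linarith)]
  obtain ⟨M, hM⟩ := exists_bound_closedBall hW r₀
  obtain ⟨N, hN⟩ := exists_bound_closedBall hfu 1
  have hVv : Continuous fun x => ⟪pFlux p (G x), ∇ v x⟫ := hV.inner hvg
  obtain ⟨S, hS⟩ := exists_bound_closedBall hVv 1
  obtain ⟨A, hA⟩ := exists_abs_dilQuot_le hu
  obtain ⟨A', hA'⟩ := exists_abs_dilQuot_le hv
  obtain ⟨H, hH⟩ := hv.continuous.bounded_above_of_compact_support
    (hasCompactSupport_of_norm_gt h0)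
  have hH0 : 0 ≤ H := (norm_nonneg _).trans (hH 0)
  have hIoo : Ioo (0 : ℝ) 1 ∈ 𝓝[>] (0 : ℝ) := Ioo_mem_nhdsGT zero_lt_one
  have L1 : Tendsto (fun h => ∫ x, f (u x) * (dilQuot u h x * v x)) (𝓝[>] 0)
      (𝓝 (∫ x, f (u x) * (⟪x, G x⟫ * v x))) := by
    refine tendsto_integral_of_bound (C := N * (A * H)) (r := r) (fun h => ?_) ?_
      (fun h x hx => by rw [h0 x hx, mul_zero, mul_zero]) fun x => ?_
    · exact (hfu.mul ((contDiff_dilQuot hu h).continuous.mul hv.continuous)).measurable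
    · filter_upwards [hIoo] with h hh x hx
      rw [norm_mul, norm_mul]
      have h1 := hA h hh x (hx.trans hr1)
      have h2 := hN x (hx.trans hr1)
      have h3 : 0 ≤ N := (norm_nonneg _).trans h2
      have h4 : 0 ≤ A := (abs_nonneg _).trans h1
      exact mul_le_mul h2 (mul_le_mul h1 (hH x) (norm_nonneg _) h4) (by positivity) h3
    · exact ((tendsto_dilQuot hu x).mul_const _).const_mul _
  have L2 : Tendsto (fun h => ∫ x, dilQuot u h x * ⟪pFlux p (G x), ∇ v x⟫) (𝓝[>] 0)
      (𝓝 (∫ x, ⟪x, G x⟫ * ⟪pFlux p (G x), ∇ v x⟫)) := by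
    refine tendsto_integral_of_bound (C := A * S) (r := r) (fun h => ?_) ?_
      (fun h x hx => by rw [zvg x hx, inner_zero_right, mul_zero]) fun x => ?_
    · exact ((contDiff_dilQuot hu h).continuous.mul (hV.inner hvg)).measurable
    · filter_upwards [hIoo] with h hh x hx
      rw [norm_mul]
      have h1 := hA h hh x (hx.trans hr1)
      exact mul_le_mul h1 (hS x (hx.trans hr1)) (norm_nonneg _) ((abs_nonneg _).trans h1)
    · exact (tendsto_dilQuot hu x).mul_const _
  have cvi : ∀ h : ℝ, Continuous fun y : Euc n => v ((1 + h)⁻¹ • y) := fun h =>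
    hv.continuous.comp (continuous_const_smul _)
  have L3 : Tendsto (fun h => ∫ y, (((1 + h) ^ (p - n) - 1) / h * v ((1 + h)⁻¹ • y)
      - dilQuot v h ((1 + h)⁻¹ • y)) * ‖G y‖ ^ p) (𝓝[>] 0)
      (𝓝 (∫ x, ((p - n) * v x - ⟪x, ∇ v x⟫) * ‖G x‖ ^ p)) := by
    refine tendsto_integral_of_bound (C := ((|p - n| + 1) * H + |A'|) * M) (r := r₀)
      (fun h => ?_) ?_ (fun h x hx => by rw [hW0 x hx, mul_zero]) fun x => ?_
    · have h1 : Continuous fun y : Euc n => dilQuot v h ((1 + h)⁻¹ • y) :=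
        (contDiff_dilQuot hv h).continuous.comp (continuous_const_smul _)
      exact (((continuous_const.mul (cvi h)).sub h1).mul hW).measurable
    · filter_upwards [hIoo, (tendsto_one_add_rpow_sub_one_div (p - n)).abs.eventually_le_const
        (lt_add_one |p - n|)] with h hh h1 x hx
      rw [norm_mul]
      have h2 : |dilQuot v h ((1 + h)⁻¹ • x)| ≤ |A'| := by
        by_cases hx1 : ‖(1 + h)⁻¹ • x‖ ≤ 1
        · exact (hA' h hh _ hx1).trans (le_abs_self _)
        · rw [not_le] at hx1
          have h3 : 0 < 1 + h := by linarith [hh.1]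
          have h4 : 1 < ‖x‖ := by
            refine hx1.trans_le ?_
            rw [norm_smul, norm_inv, Real.norm_eq_abs, abs_of_pos h3]
            refine mul_le_of_le_one_left (norm_nonneg _) (inv_le_one_of_one_le₀ ?_)
            linarith [hh.1]
          rw [dilQuot, smul_inv_smul₀ h3.ne', h0 x (by linarith), h0 _ (hr1.trans_lt hx1)]
          simp
      have h5 := hM x hx
      refine mul_le_mul ((norm_sub_le _ _).trans (add_le_add ?_ h2)) h5 (norm_nonneg _)
        (by positivity)
      rw [norm_mul]
      exact mul_le_mul h1 (hH _) (norm_nonneg _) (by positivity)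
    · refine Tendsto.mul_const _ (((tendsto_one_add_rpow_sub_one_div (p - n)).mul ?_).sub
        (tendsto_dilQuot_inv_smul hv x))
      have h1 : ContinuousAt (fun h : ℝ => v ((1 + h)⁻¹ • x)) 0 := by
        refine hv.continuous.continuousAt.comp ?_
        exact ((continuousAt_const.add continuousAt_id).inv₀ (by simp)).smul continuousAt_const
      have h2 : Tendsto (fun h : ℝ => v ((1 + h)⁻¹ • x)) (𝓝 0) (𝓝 (v x)) := by
        simpa [ContinuousAt] using h1
      exact h2.mono_left nhdsWithin_le_nhds
  refine le_of_tendsto_of_tendsto (L1.const_mul p) (L3.add (L2.const_mul p)) ?_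
  filter_upwards [hIoo] with h hh
  have hh0 : 0 < h := hh.1
  have hl : 0 < 1 + h := by linarith
  have cc := contDiff_dilQuot hu h
  have hg : ∀ x, ∇ (fun x => dilQuot u h x * v x) x
      = dilQuot u h x • ∇ v x + v x • dilQuotGrad u h x := fun x =>
    ((hasGradientAt_dilQuot hu h x).mul (hv.hasGradientAt x)).gradient
  have e1 := hw (fun x => dilQuot u h x * v x) (cc.mul hv) r hrR
    fun x hx => by rw [h0 x hx, mul_zero]
  rw [← e1]
  have c0 : Continuous fun x : Euc n => G ((1 + h) • x) := hG.comp (continuous_const_smul _)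
  have c1 : Continuous fun x : Euc n => ‖(1 + h) • G ((1 + h) • x)‖ ^ p :=
    ((continuous_const_smul (1 + h)).comp c0).norm.rpow_const fun x => Or.inr (by linarith)
  have cg : Continuous (dilQuotGrad u h) := by
    have : dilQuotGrad u h = ∇ (dilQuot u h) :=
      funext fun x => (hasGradientAt_dilQuot hu h x).gradient.symm
    rw [this]; exact cc.continuous_gradient
  have j1 : Integrable fun x => dilQuot u h x * ⟪pFlux p (G x), ∇ v x⟫ :=
    integrable_of_continuous (r := r) (cc.continuous.mul (hV.inner hvg))
      fun x hx => by rw [zvg x hx, inner_zero_right, mul_zero]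
  have j2 : Integrable fun x => v x * ⟪pFlux p (G x), dilQuotGrad u h x⟫ :=
    integrable_of_continuous (r := r) (hv.continuous.mul (hV.inner cg))
      fun x hx => by rw [h0 x hx, zero_mul]
  have j3 : Integrable fun x => ‖(1 + h) • G ((1 + h) • x)‖ ^ p * v x :=
    integrable_of_continuous (r := r) (c1.mul hv.continuous)
      fun x hx => by rw [h0 x hx, mul_zero]
  have j4 : Integrable fun x => ‖G x‖ ^ p * v x :=
    integrable_of_continuous (r := r) (hW.mul hv.continuous)
      fun x hx => by rw [h0 x hx, mul_zero]
  have j5 : Integrable fun y => v ((1 + h)⁻¹ • y) * ‖G y‖ ^ p :=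
    integrable_of_continuous (r := r₀) ((cvi h).mul hW)
      fun x hx => by rw [hW0 x hx, mul_zero]
  have e2 : ∀ x, ⟪pFlux p (G x), ∇ (fun x => dilQuot u h x * v x) x⟫
      = dilQuot u h x * ⟪pFlux p (G x), ∇ v x⟫
        + v x * ⟪pFlux p (G x), dilQuotGrad u h x⟫ := fun x => by
    rw [hg, inner_add_right, real_inner_smul_right, real_inner_smul_right]
  rw [integral_congr_ae (ae_of_all _ e2), integral_add j1 j2, mul_add, add_comm]
  gcongr ?_ + _
  have e3 : ∀ x, p * (v x * ⟪pFlux p (G x), dilQuotGrad u h x⟫)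
      ≤ h⁻¹ * (‖(1 + h) • G ((1 + h) • x)‖ ^ p * v x - ‖G x‖ ^ p * v x) := fun x => by
    have := mul_inner_pFlux_sub_le hp (G x) ((1 + h) • G ((1 + h) • x))
    rw [dilQuotGrad, real_inner_smul_right]
    calc p * (v x * (h⁻¹ * ⟪pFlux p (G x), (1 + h) • G ((1 + h) • x) - G x⟫))
        = h⁻¹ * v x * (p * ⟪pFlux p (G x), (1 + h) • G ((1 + h) • x) - G x⟫) := by ring
      _ ≤ h⁻¹ * v x * (‖(1 + h) • G ((1 + h) • x)‖ ^ p - ‖G x‖ ^ p) :=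
          mul_le_mul_of_nonneg_left this (mul_nonneg (by positivity) (hv0 x))
      _ = _ := by ring
  have e4 := integral_mono (j2.const_mul p) ((j3.sub j4).const_mul h⁻¹) e3
  rw [integral_const_mul] at e4
  refine e4.trans (le_of_eq ?_)
  have e5 : ∫ x, ‖(1 + h) • G ((1 + h) • x)‖ ^ p * v x
      = (1 + h) ^ (p - n) * ∫ y, v ((1 + h)⁻¹ • y) * ‖G y‖ ^ p := by
    have h1 := integral_comp_smul_euc (fun y => v ((1 + h)⁻¹ • y) * ‖G y‖ ^ p) hl
    simp only [inv_smul_smul₀ hl.ne'] at h1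
    rw [sub_eq_add_neg, Real.rpow_add hl, mul_assoc, ← h1, ← integral_const_mul]
    refine integral_congr_ae (ae_of_all _ fun x => ?_)
    simp only [norm_smul, Real.norm_eq_abs, abs_of_pos hl]
    rw [Real.mul_rpow hl.le (norm_nonneg _)]
    ring
  have e6 : ∀ y, (((1 + h) ^ (p - n) - 1) / h * v ((1 + h)⁻¹ • y)
      - dilQuot v h ((1 + h)⁻¹ • y)) * ‖G y‖ ^ p
      = h⁻¹ * ((1 + h) ^ (p - n) * (v ((1 + h)⁻¹ • y) * ‖G y‖ ^ p) - ‖G y‖ ^ p * v y) :=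
    fun y => by
      rw [dilQuot, smul_inv_smul₀ hl.ne', div_eq_inv_mul, div_eq_inv_mul]; ring
  rw [integral_congr_ae (ae_of_all _ e6), integral_const_mul, integral_const_mul,
    integral_sub (j5.const_mul _) j4, integral_const_mul, ← e5]
  congr 1
  exact integral_sub j3 j4

/-- The integrand of the radial stability inequality, in terms of the values of the gradient of the
solution, of the test function and of its gradient at `x`. -/
def radialIntegrand {E : Type*} [NormedAddCommGroup E] [InnerProductSpace ℝ E] (p N : ℝ)
    (x a : E) (y : ℝ) (g : E) : ℝ :=
  ⟪x, a⟫ ^ 2 * pQuad p a g + ((p - N) * y ^ 2 - 2 * y * ⟪x, g⟫) * ‖a‖ ^ p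
    + p * (⟪x, a⟫ * (2 * y * ⟪pFlux p a, g⟫))

/-- The stability inequality for the radial field, with the nonlinearity eliminated. -/
lemma WeakStable.integral_radial_nonneg {p R r : ℝ} (hp : 1 < p) {f : ℝ → ℝ}
    {u : Euc n → ℝ} (hst : WeakStable p R f u) (hw : WeakSolution p R f u)
    (hf : ContDiff ℝ 1 f) (hu : ContDiff ℝ 1 u) (huc : HasCompactSupport u) (hrR : r < R)
    (hR : R ≤ 1) {η : Euc n → ℝ} (hη : ContDiff ℝ 1 η) (h0 : ∀ x, r < ‖x‖ → η x = 0) :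
    (Integrable fun x => radialIntegrand p n x (∇ u x) (η x) (∇ η x)) ∧
      0 ≤ ∫ x, radialIntegrand p n x (∇ u x) (η x) (∇ η x) := by
  simp only [radialIntegrand]
  have h1 := hst.integral_nonneg hp hw hf hu huc hrR hR hη h0
  have hv0 : ∀ x, r < ‖x‖ → η x ^ 2 = 0 := fun x hx => by rw [h0 x hx]; ring
  have h2 := hw.pohozaev_le hp hf.continuous hu huc hrR hR (hη.pow 2)
    (fun x => sq_nonneg (η x)) hv0
  have hgrad : ∀ x, ∇ (fun y => η y ^ 2) x = (2 * η x) • ∇ η x := fun x => by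
    have h := ((hη.hasGradientAt x).mul (hη.hasGradientAt x)).gradient
    simp only [← pow_two] at h
    rw [h]; module
  simp only [hgrad, real_inner_smul_right] at h2
  have hG : Continuous (∇ u) := hu.continuous_gradient
  have hηg := hη.continuous_gradient
  have zηg : ∀ x, r < ‖x‖ → ∇ η x = 0 := fun x hx => gradient_eq_zero_of_norm_gt h0 hx
  have hV : Continuous fun x => pFlux p (∇ u x) := (continuous_pFlux (E := Euc n) hp).comp hG
  have hfu : Continuous fun x => f (u x) := hf.continuous.comp hu.continuous
  have hc : Continuous fun x => ⟪x, ∇ u x⟫ := continuous_id.inner hG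
  have hW : Continuous fun x => ‖∇ u x‖ ^ p :=
    hG.norm.rpow_const fun x => Or.inr (by linarith)
  obtain ⟨M, hM⟩ := exists_bound_closedBall hW r
  obtain ⟨L, hL⟩ := exists_bound_closedBall hηg r
  have i1 : Integrable fun x => ⟪x, ∇ u x⟫ ^ 2 * pQuad p (∇ u x) (∇ η x) := by
    have hz : ∀ x, r < ‖x‖ → ⟪x, ∇ u x⟫ ^ 2 * pQuad p (∇ u x) (∇ η x) = 0 := fun x hx => by
      rw [zηg x hx, pQuad_zero_right, mul_zero]
    refine integrable_of_bound (C := |(1 + |p - 2|) * (r ^ 2 * M) * L ^ 2|) (r := r)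
      ((hc.pow 2).measurable.mul (measurable_pQuad p hG hηg)) (fun x => ?_) hz
    rcases lt_or_ge r ‖x‖ with hx | hx
    · rw [hz x hx, norm_zero]; positivity
    · rw [norm_mul, Real.norm_eq_abs, Real.norm_eq_abs, abs_of_nonneg (sq_nonneg _)]
      refine ((inner_sq_mul_abs_pQuad_le hp x (∇ u x) (∇ η x)).trans ?_).trans (le_abs_self _)
      have h3 : ‖∇ u x‖ ^ p ≤ M := (le_abs_self _).trans (hM x hx)
      have h4 := hL x hx
      have h5 : 0 ≤ M := (by positivity : 0 ≤ ‖∇ u x‖ ^ p).trans h3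
      gcongr
  have i2 : Integrable fun x => f (u x) * (⟪x, ∇ u x⟫ * η x ^ 2) :=
    integrable_of_continuous (r := r) (hfu.mul (hc.mul (hη.continuous.pow 2)))
      fun x hx => by rw [hv0 x hx, mul_zero, mul_zero]
  have i3 : Integrable fun x => ((p - n) * η x ^ 2 - 2 * η x * ⟪x, ∇ η x⟫) * ‖∇ u x‖ ^ p :=
    integrable_of_continuous (r := r)
      (((continuous_const.mul (hη.continuous.pow 2)).sub
        ((continuous_const.mul hη.continuous).mul (continuous_id.inner hηg))).mul hW)
      fun x hx => by simp [h0 x hx]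
  have i4 : Integrable fun x => ⟪x, ∇ u x⟫ * (2 * η x * ⟪pFlux p (∇ u x), ∇ η x⟫) :=
    integrable_of_continuous (r := r)
      (hc.mul ((continuous_const.mul hη.continuous).mul (hV.inner hηg)))
      fun x hx => by simp [h0 x hx]
  have i5 : Integrable fun x => ⟪x, ∇ u x⟫ ^ 2 * pQuad p (∇ u x) (∇ η x)
      + ((p - n) * η x ^ 2 - 2 * η x * ⟪x, ∇ η x⟫) * ‖∇ u x‖ ^ p := i1.add i3
  refine ⟨i5.add (i4.const_mul p), ?_⟩
  rw [integral_add i5 (i4.const_mul p), integral_add i1 i3, integral_const_mul]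
  simp only [mul_assoc (f _)] at h1
  rw [integral_add i1 (i2.const_mul p), integral_const_mul] at h1
  simp only [mul_assoc] at h1 h2 ⊢
  linarith

end Pohozaev

/-- The regularised radial weight `(‖x‖² + s) ^ (-b / 4)`. -/
def radialWeight {E : Type*} [NormedAddCommGroup E] (b s : ℝ) (x : E) : ℝ :=
  (‖x‖ ^ 2 + s) ^ (-b / 4)

lemma radialWeight_sq {E : Type*} [NormedAddCommGroup E] (b : ℝ) {s : ℝ} (hs : 0 < s) (x : E) :
    radialWeight b s x ^ 2 = (‖x‖ ^ 2 + s) ^ (-b / 2) := by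
  rw [radialWeight, ← Real.rpow_natCast, ← Real.rpow_mul (by positivity)]
  congr 1; push_cast; ring

section RadialWeight

variable {E : Type*} [NormedAddCommGroup E] [InnerProductSpace ℝ E]

/-- The estimate of the radial integrand where the test function is the pure radial weight. -/
lemma radialIntegrand_le_neg {p N s y : ℝ} (x a : E) (hN : p < N) (hs : 0 < s) :
    radialIntegrand p N x a y (-((N - p) / 2 * (y / (‖x‖ ^ 2 + s))) • x)
      ≤ -((p * (N - p) - (N - p) ^ 2 / 4 * max 1 (p - 1)) *
          (y ^ 2 / (‖x‖ ^ 2 + s) * (‖a‖ ^ (p - 2) * ⟪x, a⟫ ^ 2))) := by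
  have hq : 0 < ‖x‖ ^ 2 + s := by positivity
  set q := ‖x‖ ^ 2 + s with hqdef
  set b := N - p with hb
  have hb0 : 0 < b := by linarith
  set w := ‖a‖ ^ (p - 2) with hw
  have hw0 : 0 ≤ w := by positivity
  set c := ⟪x, a⟫ with hc
  set m := max 1 (p - 1) with hm
  have hm0 : 0 ≤ m := zero_le_one.trans (le_max_left _ _)
  have h1 : pQuad p a x ≤ m * (w * ‖x‖ ^ 2) := pQuad_le p a x
  have hfl : ⟪pFlux p a, x⟫ = w * c := by
    rw [pFlux, real_inner_smul_left, real_inner_comm]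
  have hxq : ‖x‖ ^ 2 ≤ q := by linarith
  rw [radialIntegrand, pQuad_smul_right, real_inner_smul_right, real_inner_smul_right,
    real_inner_self_eq_norm_sq, hfl, show p - N = -b by rw [hb]; ring]
  have t1 : c ^ 2 * ((-(b / 2 * (y / q))) ^ 2 * pQuad p a x)
      ≤ b ^ 2 / 4 * m * (y ^ 2 / q * (w * c ^ 2)) := by
    calc c ^ 2 * ((-(b / 2 * (y / q))) ^ 2 * pQuad p a x)
        ≤ c ^ 2 * ((-(b / 2 * (y / q))) ^ 2 * (m * (w * q))) := by
          have h2 : pQuad p a x ≤ m * (w * q) := h1.trans (by gcongr)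
          gcongr
      _ = _ := by field_simp; ring
  have t2 : (-b * y ^ 2 - 2 * y * (-(b / 2 * (y / q)) * ‖x‖ ^ 2)) * ‖a‖ ^ p ≤ 0 := by
    refine mul_nonpos_of_nonpos_of_nonneg ?_ (by positivity)
    have : -b * y ^ 2 - 2 * y * (-(b / 2 * (y / q)) * ‖x‖ ^ 2)
        = -(b * y ^ 2 * (1 - ‖x‖ ^ 2 / q)) := by ring
    rw [this, neg_nonpos]
    have : ‖x‖ ^ 2 / q ≤ 1 := (div_le_one hq).2 hxq
    exact mul_nonneg (by positivity) (by linarith)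
  have t3 : p * (c * (2 * y * (-(b / 2 * (y / q)) * (w * c))))
      = -(p * b * (y ^ 2 / q * (w * c ^ 2))) := by ring
  rw [t3]
  linarith

/-- A crude bound for the radial integrand. -/
lemma radialIntegrand_le {p N y φ L : ℝ} (hp : 1 < p) {x a g : E} (hN : p < N) (hy : 0 ≤ y)
    (hyφ : y ≤ φ) (hg : ‖x‖ * ‖g‖ ≤ L * φ) :
    radialIntegrand p N x a y g
      ≤ ((1 + |p - 2|) * L ^ 2 + 2 * L + 2 * p * L) * (φ ^ 2 * ‖a‖ ^ p) := by
  have hW : 0 ≤ ‖a‖ ^ p := by positivity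
  have hxg : 0 ≤ ‖x‖ * ‖g‖ := by positivity
  have hφ : 0 ≤ φ := hy.trans hyφ
  have hLφ : 0 ≤ L * φ := hxg.trans hg
  have t1 : ⟪x, a⟫ ^ 2 * pQuad p a g ≤ (1 + |p - 2|) * (L * φ) ^ 2 * ‖a‖ ^ p := by
    calc ⟪x, a⟫ ^ 2 * pQuad p a g ≤ ⟪x, a⟫ ^ 2 * |pQuad p a g| := by
          gcongr; exact le_abs_self _
      _ ≤ (1 + |p - 2|) * (‖x‖ ^ 2 * ‖a‖ ^ p) * ‖g‖ ^ 2 := inner_sq_mul_abs_pQuad_le hp x a g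
      _ = (1 + |p - 2|) * (‖x‖ * ‖g‖) ^ 2 * ‖a‖ ^ p := by ring
      _ ≤ _ := by gcongr
  have t2 : ((p - N) * y ^ 2 - 2 * y * ⟪x, g⟫) * ‖a‖ ^ p ≤ 2 * (φ * (L * φ)) * ‖a‖ ^ p := by
    refine mul_le_mul_of_nonneg_right ?_ hW
    have h1 : (p - N) * y ^ 2 ≤ 0 := mul_nonpos_of_nonpos_of_nonneg (by linarith) (sq_nonneg y)
    have h2 : -⟪x, g⟫ ≤ L * φ := (neg_le_abs _).trans ((abs_real_inner_le_norm x g).trans hg)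
    have h3 : y * -⟪x, g⟫ ≤ φ * (L * φ) :=
      (mul_le_mul_of_nonneg_left h2 hy).trans (mul_le_mul_of_nonneg_right hyφ hLφ)
    linarith
  have hpow : ‖a‖ * ‖a‖ ^ (p - 1) = ‖a‖ ^ p := by
    rcases eq_or_ne ‖a‖ 0 with h | h
    · rw [h, Real.zero_rpow (by linarith : p ≠ 0), zero_mul]
    · rw [Real.rpow_sub_one h]; field_simp
  have t3 : p * (⟪x, a⟫ * (2 * y * ⟪pFlux p a, g⟫)) ≤ p * (2 * (φ * (L * φ)) * ‖a‖ ^ p) := by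
    refine mul_le_mul_of_nonneg_left ?_ (by linarith)
    calc ⟪x, a⟫ * (2 * y * ⟪pFlux p a, g⟫) ≤ |⟪x, a⟫ * (2 * y * ⟪pFlux p a, g⟫)| := le_abs_self _
      _ = |⟪x, a⟫| * (2 * y * |⟪pFlux p a, g⟫|) := by
          rw [abs_mul, abs_mul, abs_of_nonneg (by linarith : 0 ≤ 2 * y)]
      _ ≤ (‖x‖ * ‖a‖) * (2 * y * (‖a‖ ^ (p - 1) * ‖g‖)) := by
          have h1 := abs_real_inner_le_norm x a
          have h2 := abs_real_inner_le_norm (pFlux p a) g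
          rw [norm_pFlux hp] at h2
          gcongr
      _ = 2 * (y * (‖x‖ * ‖g‖)) * (‖a‖ * ‖a‖ ^ (p - 1)) := by ring
      _ ≤ _ := by rw [hpow]; gcongr
  rw [radialIntegrand]
  calc _ ≤ (1 + |p - 2|) * (L * φ) ^ 2 * ‖a‖ ^ p + 2 * (φ * (L * φ)) * ‖a‖ ^ p
        + p * (2 * (φ * (L * φ)) * ‖a‖ ^ p) := add_le_add (add_le_add t1 t2) t3
    _ = _ := by ring

lemma contDiff_radialWeight (b : ℝ) {s : ℝ} (hs : 0 < s) :
    ContDiff ℝ 1 (radialWeight b s : E → ℝ) := by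
  unfold radialWeight
  refine ContDiff.rpow_const_of_ne ((contDiff_norm_sq ℝ).add contDiff_const) fun x => ?_
  positivity

lemma hasGradientAt_radialWeight [CompleteSpace E] (b : ℝ) {s : ℝ} (hs : 0 < s) (x : E) :
    HasGradientAt (radialWeight b s : E → ℝ)
      (-(b / 2 * (radialWeight b s x / (‖x‖ ^ 2 + s))) • x) x := by
  have hq : 0 < ‖x‖ ^ 2 + s := by positivity
  have h1 : HasGradientAt (fun y : E => ‖y‖ ^ 2 + s) ((2 : ℝ) • x) x := by
    rw [hasGradientAt_iff_hasFDerivAt]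
    have := ((hasStrictFDerivAt_norm_sq x).hasFDerivAt).add_const s
    refine this.congr_fderiv ?_
    ext v
    simp
  have h2 := HasDerivAt.comp_hasGradientAt (f := fun y : E => ‖y‖ ^ 2 + s)
    (φ := fun t : ℝ => t ^ (-b / 4)) (Real.hasDerivAt_rpow_const (Or.inl hq.ne')) h1
  convert h2 using 1
  · rfl
  rw [smul_smul, radialWeight, Real.rpow_sub_one hq.ne']
  congr 1
  field_simp
  ring

end RadialWeight

section Cutoff

variable {n : ℕ}

lemma exists_radial_cutoff (n : ℕ) : ∃ L : ℝ, 0 ≤ L ∧ ∀ ρ : ℝ, 0 < ρ → ∃ ζ : Euc n → ℝ,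
    ContDiff ℝ 1 ζ ∧ (∀ x, 0 ≤ ζ x ∧ ζ x ≤ 1) ∧ (∀ x, ‖x‖ < ρ → ζ x = 1 ∧ ∇ ζ x = 0) ∧
    (∀ x, 5 / 4 * ρ < ‖x‖ → ζ x = 0) ∧ ∀ x, ρ * ‖∇ ζ x‖ ≤ L := by
  let χ : ContDiffBump (0 : Euc n) := ⟨1, 5 / 4, one_pos, by norm_num⟩
  have hχ : ContDiff ℝ 1 χ := χ.contDiff
  obtain ⟨L, hL⟩ := hχ.continuous_gradient.bounded_above_of_compact_support
    χ.hasCompactSupport.gradient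
  refine ⟨L, (norm_nonneg _).trans (hL 0), fun ρ hρ => ⟨fun x => χ (ρ⁻¹ • x),
    hχ.comp (contDiff_const_smul _), fun x => ⟨χ.nonneg, χ.le_one⟩, fun x hx => ?_,
    fun x hx => ?_, fun x => ?_⟩⟩
  · have h1 : ∀ y : Euc n, ‖y‖ < ρ → χ (ρ⁻¹ • y) = 1 := fun y hy => by
      refine χ.one_of_mem_closedBall ?_
      rw [mem_closedBall_zero_iff, norm_smul, norm_inv, Real.norm_eq_abs, abs_of_pos hρ,
        inv_mul_le_iff₀ hρ]
      show ‖y‖ ≤ ρ * 1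
      linarith
    refine ⟨h1 x hx, ?_⟩
    have h2 : (fun y : Euc n => χ (ρ⁻¹ • y)) =ᶠ[𝓝 x] fun _ => 1 := by
      filter_upwards [continuous_norm.continuousAt.eventually_lt_const hx] with y hy
      exact h1 y hy
    rw [Filter.EventuallyEq.gradient_eq h2]
    exact (hasGradientAt_const x (1 : ℝ)).gradient
  · refine χ.zero_of_le_dist ?_
    rw [dist_zero_right, norm_smul, norm_inv, Real.norm_eq_abs, abs_of_pos hρ]
    show 5 / 4 ≤ ρ⁻¹ * ‖x‖
    rw [inv_mul_eq_div, le_div_iff₀ hρ]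
    exact hx.le
  · rw [((hχ.hasGradientAt (ρ⁻¹ • x)).comp_smul ρ⁻¹).gradient, norm_smul, norm_inv,
      Real.norm_eq_abs, abs_of_pos hρ, mul_inv_cancel_left₀ hρ.ne']
    exact hL _

end Cutoff

section WeightedEstimate

variable {n : ℕ}

/-- The pointwise estimate of the radial integrand for the truncated radial weight. -/
lemma radialIntegrand_cutoff_le {p s ρ L : ℝ} (hp : 1 < p) (hnp : p < n) (hs : 0 < s)
    (hρ : 0 < ρ) {ζ : Euc n → ℝ} (hζ : ContDiff ℝ 1 ζ) (hζ01 : ∀ x, 0 ≤ ζ x ∧ ζ x ≤ 1)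
    (hζ1 : ∀ x, ‖x‖ < ρ → ζ x = 1 ∧ ∇ ζ x = 0) (hζ0 : ∀ x, 5 / 4 * ρ < ‖x‖ → ζ x = 0)
    (hζL : ∀ x, ρ * ‖∇ ζ x‖ ≤ L) (x a : Euc n) :
    let η := fun y => radialWeight (n - p) s y * ζ y
    let K := (n - p) / 2 + 3 / 2 * L
    radialIntegrand p n x a (η x) (∇ η x)
      ≤ (ball (0 : Euc n) (3 * ρ / 2) \ ball 0 ρ).indicator (fun _ =>
          ((1 + |p - 2|) * K ^ 2 + 2 * K + 2 * p * K) * (ρ ^ (p - n) * ‖a‖ ^ p)) x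
        - (ball (0 : Euc n) ρ).indicator (fun y =>
          (p * (n - p) - (n - p) ^ 2 / 4 * max 1 (p - 1)) *
          ((‖y‖ ^ 2 + s) ^ (-(n - p) / 2) / (‖y‖ ^ 2 + s) * (‖a‖ ^ (p - 2) * ⟪y, a⟫ ^ 2))) x := by
  intro η K
  have hq : 0 < ‖x‖ ^ 2 + s := by positivity
  have hη : ∇ η x = radialWeight (n - p) s x • ∇ ζ x
      + ζ x • (-((n - p) / 2 * (radialWeight (n - p) s x / (‖x‖ ^ 2 + s))) • x) :=
    ((hasGradientAt_radialWeight (n - p) hs x).mul (hζ.hasGradientAt x)).gradient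
  have hL : 0 ≤ L := (by positivity : 0 ≤ ρ * ‖∇ ζ 0‖).trans (hζL 0)
  have hK : 0 ≤ K := by
    have : 0 ≤ (n : ℝ) - p := by linarith
    positivity
  have hφ : 0 ≤ radialWeight (n - p) s x := by unfold radialWeight; positivity
  rcases lt_or_ge ‖x‖ ρ with hx | hx
  · have hmem : x ∈ ball (0 : Euc n) ρ := mem_ball_zero_iff.2 hx
    rw [indicator_of_notMem (fun h => h.2 hmem), indicator_of_mem hmem, zero_sub, hη,
      (hζ1 x hx).2, smul_zero, zero_add, (hζ1 x hx).1, one_smul, ← radialWeight_sq _ hs]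
    simp only [η, (hζ1 x hx).1, mul_one]
    exact radialIntegrand_le_neg x a hnp hs
  · have hnm : x ∉ ball (0 : Euc n) ρ := fun h => hx.not_gt (mem_ball_zero_iff.1 h)
    rw [indicator_of_notMem hnm, sub_zero]
    rcases lt_or_ge ‖x‖ (3 * ρ / 2) with hx2 | hx2
    · have hmem : x ∈ ball (0 : Euc n) (3 * ρ / 2) \ ball 0 ρ := ⟨mem_ball_zero_iff.2 hx2, hnm⟩
      rw [indicator_of_mem hmem]
      have hyφ : η x ≤ radialWeight (n - p) s x :=
        mul_le_of_le_one_right hφ (hζ01 x).2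
      have hg : ‖x‖ * ‖∇ η x‖ ≤ K * radialWeight (n - p) s x := by
        rw [hη]
        have h1 : ‖x‖ * ‖∇ ζ x‖ ≤ 3 / 2 * L := by
          calc ‖x‖ * ‖∇ ζ x‖ ≤ 3 * ρ / 2 * ‖∇ ζ x‖ := by gcongr
            _ = 3 / 2 * (ρ * ‖∇ ζ x‖) := by ring
            _ ≤ _ := by gcongr; exact hζL x
        have h2 : ‖x‖ ^ 2 / (‖x‖ ^ 2 + s) ≤ 1 := (div_le_one hq).2 (by linarith)
        have hb : 0 ≤ ((n : ℝ) - p) / 2 := by linarith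
        calc ‖x‖ * ‖radialWeight (n - p) s x • ∇ ζ x
              + ζ x • (-((n - p) / 2 * (radialWeight (n - p) s x / (‖x‖ ^ 2 + s))) • x)‖
            ≤ ‖x‖ * (radialWeight (n - p) s x * ‖∇ ζ x‖
              + 1 * ((n - p) / 2 * (radialWeight (n - p) s x / (‖x‖ ^ 2 + s)) * ‖x‖)) := by
              gcongr
              refine (norm_add_le _ _).trans (add_le_add ?_ ?_)
              · rw [norm_smul, Real.norm_of_nonneg hφ]
              · rw [norm_smul, norm_smul, norm_neg, Real.norm_of_nonneg (hζ01 x).1,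
                  Real.norm_of_nonneg (by positivity)]
                gcongr
                exact (hζ01 x).2
          _ = radialWeight (n - p) s x * (‖x‖ * ‖∇ ζ x‖)
              + (n - p) / 2 * radialWeight (n - p) s x * (‖x‖ ^ 2 / (‖x‖ ^ 2 + s)) := by ring
          _ ≤ radialWeight (n - p) s x * (3 / 2 * L)
              + (n - p) / 2 * radialWeight (n - p) s x * 1 := by gcongr
          _ = _ := by ring
      refine (radialIntegrand_le hp hnp (mul_nonneg hφ (hζ01 x).1) hyφ hg).trans ?_
      have h3 : radialWeight (n - p) s x ^ 2 ≤ ρ ^ (p - n) := by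
        rw [radialWeight_sq _ hs]
        calc (‖x‖ ^ 2 + s) ^ (-((n : ℝ) - p) / 2) ≤ (ρ ^ 2) ^ (-((n : ℝ) - p) / 2) := by
              refine Real.rpow_le_rpow_of_nonpos (by positivity) ?_ (by linarith)
              nlinarith
          _ = _ := by
              rw [← Real.rpow_natCast, ← Real.rpow_mul hρ.le]
              congr 1; push_cast; ring
      gcongr
    · have hx3 : 5 / 4 * ρ < ‖x‖ := by linarith
      rw [indicator_of_notMem fun h => hx2.not_gt (mem_ball_zero_iff.1 h.1)]
      have h4 : ∇ η x = 0 := gradient_eq_zero_of_norm_gt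
        (fun y hy => by simp only [η, hζ0 y hy, mul_zero]) hx3
      rw [h4]
      simp [η, hζ0 x hx3, radialIntegrand, pQuad]

/-- The weighted estimate with a regularised weight. -/
lemma WeakStable.setIntegral_radialWeight_le {p s ρ L : ℝ} (hp : 1 < p) (hnp : p < n)
    {f : ℝ → ℝ} {u : Euc n → ℝ} (hρ : 0 < ρ) (hρ1 : 3 * ρ / 2 ≤ 1)
    (hst : WeakStable p (3 * ρ / 2) f u) (hw : WeakSolution p (3 * ρ / 2) f u)
    (hf : ContDiff ℝ 1 f) (hu : ContDiff ℝ 1 u) (huc : HasCompactSupport u) (hs : 0 < s)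
    {ζ : Euc n → ℝ} (hζ : ContDiff ℝ 1 ζ) (hζ01 : ∀ x, 0 ≤ ζ x ∧ ζ x ≤ 1)
    (hζ1 : ∀ x, ‖x‖ < ρ → ζ x = 1 ∧ ∇ ζ x = 0) (hζ0 : ∀ x, 5 / 4 * ρ < ‖x‖ → ζ x = 0)
    (hζL : ∀ x, ρ * ‖∇ ζ x‖ ≤ L) :
    let K := (n - p) / 2 + 3 / 2 * L
    (p * (n - p) - (n - p) ^ 2 / 4 * max 1 (p - 1)) *
      ∫ x in ball (0 : Euc n) ρ, (‖x‖ ^ 2 + s) ^ (-(n - p) / 2) / (‖x‖ ^ 2 + s) *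
        (‖∇ u x‖ ^ (p - 2) * ⟪x, ∇ u x⟫ ^ 2)
      ≤ ((1 + |p - 2|) * K ^ 2 + 2 * K + 2 * p * K) * (ρ ^ (p - n) *
        ∫ x in ball (0 : Euc n) (3 * ρ / 2) \ ball 0 ρ, ‖∇ u x‖ ^ p) := by
  intro K
  obtain ⟨hInt, hpos⟩ := hst.integral_radial_nonneg hp hw hf hu huc
    (by linarith : 5 / 4 * ρ < 3 * ρ / 2) hρ1
    ((contDiff_radialWeight (n - p) hs).mul hζ) (fun x hx => by rw [hζ0 x hx, mul_zero])
  have hpt := fun x => radialIntegrand_cutoff_le hp hnp hs hρ hζ hζ01 hζ1 hζ0 hζL x (∇ u x)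
  dsimp only at hpt
  set κ := p * (n - p) - (n - p) ^ 2 / 4 * max 1 (p - 1)
  set C := (1 + |p - 2|) * K ^ 2 + 2 * K + 2 * p * K
  set A := ball (0 : Euc n) (3 * ρ / 2) \ ball 0 ρ
  have hA : MeasurableSet A := measurableSet_ball.diff measurableSet_ball
  have hcont : Continuous fun x => ‖∇ u x‖ ^ p :=
    hu.continuous_gradient.norm.rpow_const fun x => Or.inr (by linarith)
  have hwc : Continuous fun x : Euc n =>
      (‖x‖ ^ 2 + s) ^ (-((n : ℝ) - p) / 2) / (‖x‖ ^ 2 + s) := by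
    have hc : Continuous fun x : Euc n => ‖x‖ ^ 2 + s := by fun_prop
    exact (hc.rpow_const fun x => Or.inl (by positivity)).div hc fun x => by positivity
  have hI1 : IntegrableOn (fun x => C * (ρ ^ (p - n) * ‖∇ u x‖ ^ p)) A :=
    ((continuous_const.mul (continuous_const.mul hcont)).continuousOn.integrableOn_compact
      (isCompact_closedBall 0 (3 * ρ / 2))).mono_set (sdiff_subset.trans ball_subset_closedBall)
  have hI2 : IntegrableOn (fun x => κ * ((‖x‖ ^ 2 + s) ^ (-((n : ℝ) - p) / 2) / (‖x‖ ^ 2 + s) *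
      (‖∇ u x‖ ^ (p - 2) * ⟪x, ∇ u x⟫ ^ 2))) (ball (0 : Euc n) ρ) := by
    refine Integrable.const_mul ?_ κ
    obtain ⟨M, hM⟩ := exists_bound_closedBall
      (hwc.mul ((continuous_norm.pow 2).mul hcont)) ρ
    refine Measure.integrableOn_of_bounded (M := M) measure_ball_lt_top.ne ?_ ?_
    · have hm : Measurable (∇ u) := hu.continuous_gradient.measurable
      have hi : Continuous fun x => ⟪x, ∇ u x⟫ := continuous_id.inner hu.continuous_gradient
      exact (hwc.measurable.mul ((hm.norm.pow_const _).mul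
        (hi.measurable.pow_const 2))).aestronglyMeasurable
    · refine (ae_restrict_iff' measurableSet_ball).2 (ae_of_all _ fun x hx => ?_)
      rw [Real.norm_of_nonneg (by positivity)]
      exact (mul_le_mul_of_nonneg_left (norm_rpow_sub_two_mul_inner_sq_le hp x (∇ u x))
        (by positivity)).trans ((le_abs_self _).trans (hM x (mem_ball_zero_iff.1 hx).le))
  have hle := hpos.trans (integral_mono hInt
    ((hI1.integrable_indicator hA).sub (hI2.integrable_indicator measurableSet_ball))
    (fun x => by
      classical
      refine (hpt x).trans_eq ?_
      simp only [Pi.sub_apply, indicator_apply]))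
  simp only [Pi.sub_apply] at hle
  rw [integral_sub (hI1.integrable_indicator hA) (hI2.integrable_indicator measurableSet_ball),
    integral_indicator hA, integral_indicator measurableSet_ball, integral_const_mul,
    integral_const_mul, integral_const_mul] at hle
  linarith

/-- Monotone passage to the limit in the regularised weight. -/
lemma setIntegral_radialDeriv_le {p ρ B : ℝ} (hnp : p < n) {u : Euc n → ℝ}
    (hu : ContDiff ℝ 1 u) (hB : 0 ≤ B)
    (h : ∀ s > 0, ∫ x in ball (0 : Euc n) ρ, (‖x‖ ^ 2 + s) ^ (-(n - p) / 2) / (‖x‖ ^ 2 + s) *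
        (‖∇ u x‖ ^ (p - 2) * ⟪x, ∇ u x⟫ ^ 2) ≤ B) :
    ∫ x in ball (0 : Euc n) ρ, ‖x‖ ^ (p - n) * ‖∇ u x‖ ^ (p - 2) * radialDeriv u x ^ 2 ≤ B := by
  by_cases hi : IntegrableOn
      (fun x => ‖x‖ ^ (p - n) * ‖∇ u x‖ ^ (p - 2) * radialDeriv u x ^ 2) (ball (0 : Euc n) ρ)
  swap
  · rwa [integral_undef hi]
  have hlim : Tendsto (fun s : ℝ => ∫ x in ball (0 : Euc n) ρ,
      (‖x‖ ^ 2 + s) ^ (-((n : ℝ) - p) / 2) / (‖x‖ ^ 2 + s) *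
        (‖∇ u x‖ ^ (p - 2) * ⟪x, ∇ u x⟫ ^ 2)) (𝓝[>] 0)
      (𝓝 (∫ x in ball (0 : Euc n) ρ,
        ‖x‖ ^ (p - n) * ‖∇ u x‖ ^ (p - 2) * radialDeriv u x ^ 2)) := by
    have hrw : ∀ x : Euc n, x ≠ 0 →
        ‖x‖ ^ (p - n) * ‖∇ u x‖ ^ (p - 2) * radialDeriv u x ^ 2
          = (‖x‖ ^ 2) ^ (-((n : ℝ) - p) / 2) / ‖x‖ ^ 2 *
            (‖∇ u x‖ ^ (p - 2) * ⟪x, ∇ u x⟫ ^ 2) := fun x hx => by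
      have h1 : (‖x‖ ^ 2) ^ (-((n : ℝ) - p) / 2) = ‖x‖ ^ (p - n) := by
        rw [← Real.rpow_natCast, ← Real.rpow_mul (norm_nonneg x)]
        congr 1; push_cast; ring
      rw [h1, radialDeriv, div_pow]
      ring
    refine tendsto_integral_filter_of_dominated_convergence _ ?_ ?_ hi ?_
    · refine Eventually.of_forall fun s => Measurable.aestronglyMeasurable ?_
      have hm : Measurable (∇ u) := hu.continuous_gradient.measurable
      have hin : Continuous fun x => ⟪x, ∇ u x⟫ := continuous_id.inner hu.continuous_gradient
      have hq : Measurable fun x : Euc n => ‖x‖ ^ 2 + s := by fun_prop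
      exact ((hq.pow_const _).div hq).mul ((hm.norm.pow_const _).mul (hin.measurable.pow_const 2))
    · filter_upwards [self_mem_nhdsWithin] with s hs
      refine ae_of_all _ fun x => ?_
      have hs : 0 < s := hs
      rcases eq_or_ne x 0 with rfl | hx
      · simp [radialDeriv]
      · have hx0 : 0 < ‖x‖ := norm_pos_iff.2 hx
        rw [hrw x hx, Real.norm_of_nonneg (by positivity)]
        have h2 : (‖x‖ ^ 2 + s) ^ (-((n : ℝ) - p) / 2) ≤ (‖x‖ ^ 2) ^ (-((n : ℝ) - p) / 2) :=
          Real.rpow_le_rpow_of_nonpos (by positivity) (by linarith) (by linarith)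
        gcongr
        linarith
    · refine ae_of_all _ fun x => ?_
      rcases eq_or_ne x 0 with rfl | hx
      · simp [radialDeriv]
      · have hx0 : 0 < ‖x‖ := norm_pos_iff.2 hx
        rw [hrw x hx]
        refine Tendsto.mul_const _ ?_
        have hq : Tendsto (fun s : ℝ => ‖x‖ ^ 2 + s) (𝓝[>] 0) (𝓝 (‖x‖ ^ 2)) := by
          have : Continuous fun s : ℝ => ‖x‖ ^ 2 + s := by fun_prop
          simpa using (this.tendsto 0).mono_left nhdsWithin_le_nhds
        exact (hq.rpow_const (Or.inl (by positivity))).div hq (by positivity)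
  exact le_of_tendsto hlim (by
    filter_upwards [self_mem_nhdsWithin] with s hs using h s hs)

lemma radial_constant_pos {p : ℝ} (hp : 1 < p) (hnp : p < n) (hdim : DimensionCondition n p) :
    0 < p * (n - p) - (n - p) ^ 2 / 4 * max 1 (p - 1) := by
  have hb : 0 < (n : ℝ) - p := by linarith
  suffices ((n : ℝ) - p) * max 1 (p - 1) < 4 * p by nlinarith
  rcases le_or_gt 2 p with h | h
  · have h1 := hdim.1 h
    rw [max_eq_right (by linarith), ← lt_div_iff₀ (by linarith)]
    linarith
  · have h1 := hdim.2 h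
    rw [max_eq_left (by linarith)]
    linarith

/-- The stability estimate for globally defined functions. -/
theorem exists_const_stability (p : ℝ) (hp : 1 < p) (hnp : p < n)
    (hdim : DimensionCondition n p) : ∃ C : ℝ, 0 < C ∧ ∀ (f : ℝ → ℝ) (u : Euc n → ℝ) (ρ : ℝ),
      ContDiff ℝ 1 f → ContDiff ℝ 1 u → HasCompactSupport u → 0 < ρ → 3 * ρ / 2 ≤ 1 →
      WeakStable p (3 * ρ / 2) f u → WeakSolution p (3 * ρ / 2) f u →
      ∫ x in ball (0 : Euc n) ρ, ‖x‖ ^ (p - n) * ‖∇ u x‖ ^ (p - 2) * radialDeriv u x ^ 2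
        ≤ C * ρ ^ (p - n) * ∫ x in ball (0 : Euc n) (3 * ρ / 2) \ ball 0 ρ, ‖∇ u x‖ ^ p := by
  obtain ⟨L, hL, hcut⟩ := exists_radial_cutoff n
  have hκ := radial_constant_pos hp hnp hdim
  set κ := p * (n - p) - (n - p) ^ 2 / 4 * max 1 (p - 1) with hκdef
  set K := ((n : ℝ) - p) / 2 + 3 / 2 * L with hKdef
  have hK : 0 < K := by
    have : 0 < (n : ℝ) - p := by linarith
    positivity
  refine ⟨((1 + |p - 2|) * K ^ 2 + 2 * K + 2 * p * K) / κ, by positivity,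
    fun f u ρ hf hu huc hρ hρ1 hst hw => ?_⟩
  obtain ⟨ζ, hζ, hζ01, hζ1, hζ0, hζL⟩ := hcut ρ hρ
  have hI : 0 ≤ ∫ x in ball (0 : Euc n) (3 * ρ / 2) \ ball 0 ρ, ‖∇ u x‖ ^ p :=
    integral_nonneg fun x => by positivity
  refine setIntegral_radialDeriv_le hnp hu (by positivity) fun s hs => ?_
  have h := hst.setIntegral_radialWeight_le hp hnp hρ hρ1 hw hf hu huc hs hζ hζ01 hζ1 hζ0 hζL
  dsimp only at h
  rw [← hκdef, ← hKdef, mul_comm, ← le_div_iff₀ hκ] at h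
  refine h.trans_eq ?_
  ring

end WeightedEstimate

section Localization

variable {n : ℕ}

lemma exists_contDiff_extension {u : Euc n → ℝ} (hu : ContDiffOn ℝ 1 u (ball 0 1)) {R : ℝ}
    (hR0 : 0 < R) (hR : R < 1) : ∃ v : Euc n → ℝ, ContDiff ℝ 1 v ∧ HasCompactSupport v ∧
      ∀ x, ‖x‖ < R → v x = u x ∧ ∇ v x = ∇ u x := by
  let χ : ContDiffBump (0 : Euc n) := ⟨R, (1 + R) / 2, hR0, by linarith⟩
  have hval : ∀ x, ‖x‖ < R → χ x * u x = u x := fun x hx => by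
    rw [χ.one_of_mem_closedBall (mem_closedBall_zero_iff.2 hx.le), one_mul]
  refine ⟨fun x => χ x * u x, contDiff_iff_contDiffAt.2 fun x => ?_,
    χ.hasCompactSupport.mul_right, fun x hx => ⟨hval x hx, ?_⟩⟩
  · by_cases h1 : x ∈ tsupport χ
    · rw [χ.tsupport_eq, mem_closedBall_zero_iff] at h1
      have h2 : ‖x‖ < 1 := h1.trans_lt (show (1 + R) / 2 < 1 by linarith)
      exact χ.contDiffAt.mul (hu.contDiffAt (isOpen_ball.mem_nhds (mem_ball_zero_iff.2 h2)))
    · refine (contDiffAt_const (c := (0 : ℝ))).congr_of_eventuallyEq ?_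
      filter_upwards [notMem_tsupport_iff_eventuallyEq.1 h1] with y hy
      rw [hy, Pi.zero_apply, zero_mul]
  · refine Filter.EventuallyEq.gradient_eq ?_
    filter_upwards [continuous_norm.continuousAt.eventually_lt_const hx] with y hy
    exact hval y hy

lemma tsupport_subset_ball {ξ : Euc n → ℝ} {r : ℝ} (hr : r < 1) (h0 : ∀ x, r < ‖x‖ → ξ x = 0) :
    tsupport ξ ⊆ ball 0 1 := by
  refine (closure_minimal (fun x hx => ?_) isClosed_closedBall).trans
    (closedBall_subset_ball hr)
  by_contra hc
  exact hx (h0 x (by simpa using hc))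

lemma IsRegularSolution.weakSolution {p R : ℝ} {f : ℝ → ℝ} {u v : Euc n → ℝ}
    (h : IsRegularSolution n p (ball 0 1) f u) (hR : R < 1)
    (hv : ∀ x, ‖x‖ < R → v x = u x ∧ ∇ v x = ∇ u x) : WeakSolution p R f v := by
  intro ξ hξ r hr h0
  have hg0 : ∀ x, r < ‖x‖ → ∇ ξ x = 0 := fun x hx => gradient_eq_zero_of_norm_gt h0 hx
  have key := h.2.2 ξ hξ (hasCompactSupport_of_norm_gt h0) (tsupport_subset_ball (hr.trans hR) h0)
  have hout : ∀ x, x ∉ ball (0 : Euc n) 1 → r < ‖x‖ := fun x hx => by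
    have : 1 ≤ ‖x‖ := by simpa using hx
    linarith
  rw [setIntegral_eq_integral_of_forall_compl_eq_zero fun x hx => by
      rw [hg0 x (hout x hx), inner_zero_right, mul_zero],
    setIntegral_eq_integral_of_forall_compl_eq_zero fun x hx => by
      rw [h0 x (hout x hx), mul_zero]] at key
  convert key using 3 with x x
  · rcases lt_or_ge ‖x‖ R with hx | hx
    · rw [(hv x hx).2, pFlux, real_inner_smul_left]
    · rw [hg0 x (hr.trans_le hx), inner_zero_right, inner_zero_right, mul_zero]
  · rcases lt_or_ge ‖x‖ R with hx | hx
    · rw [(hv x hx).1]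
    · rw [h0 x (hr.trans_le hx), mul_zero, mul_zero]

lemma IsStableRegularSolution.weakStable {p R : ℝ} {f : ℝ → ℝ} {u v : Euc n → ℝ}
    (h : IsStableRegularSolution n p (ball 0 1) f u) (hR : R < 1)
    (hv : ∀ x, ‖x‖ < R → v x = u x ∧ ∇ v x = ∇ u x) : WeakStable p R f v := by
  intro ξ hξ r hr h0 hcrit
  have hg0 : ∀ x, r < ‖x‖ → ∇ ξ x = 0 := fun x hx => gradient_eq_zero_of_norm_gt h0 hx
  have hcs : HasCompactSupport ξ := hasCompactSupport_of_norm_gt h0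
  have key := h.2 ξ (hξ.lipschitzWith_of_hasCompactSupport hcs one_ne_zero) hcs
    (tsupport_subset_ball (hr.trans hR) h0)
  have hout : ∀ x, x ∉ ball (0 : Euc n) 1 → r < ‖x‖ := fun x hx => by
    have : 1 ≤ ‖x‖ := by simpa using hx
    linarith
  rw [setIntegral_eq_integral_of_forall_compl_eq_zero fun x hx => by
      have hz : ∇ ξ x = 0 := by
        by_cases hx1 : r < ‖x‖
        · exact hg0 x hx1
        · refine hcrit x ?_
          rw [(hv x (by linarith)).2]
          by_contra hne
          exact hx ⟨by_contra fun hb => hx1 (hout x hb), norm_pos_iff.2 hne⟩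
      rw [hz]; simp,
    setIntegral_eq_integral_of_forall_compl_eq_zero fun x hx => by
      rw [h0 x (hout x hx)]; simp] at key
  convert key using 4 with x x
  · rcases lt_or_ge ‖x‖ R with hx | hx
    · rw [(hv x hx).2, pQuad]
    · rw [hg0 x (hr.trans_le hx)]; simp [pQuad]
  · rcases lt_or_ge ‖x‖ R with hx | hx
    · rw [(hv x hx).1]
    · rw [h0 x (hr.trans_le hx)]; simp

end Localization

/-- Lemma 2.1: the key stability estimate. If `n > p` and the dimension
condition (★) holds, then for every stable regular solution `u` of `−Δ_p u = f(u)` in `B₁`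
and every `ρ ∈ (0, 2/3)`,
`∫_{B_ρ} r^{p−n} |∇u|^{p−2} u_r² dx ≤ C ρ^{p−n} ∫_{B_{3ρ/2}∖B_ρ} |∇u|^p dx`,
where `C` depends only on `n` and `p`. -/
theorem statement0 (n : ℕ) (p : ℝ) (hp : 1 < p) (hnp : p < (n : ℝ))
    (hdim : DimensionCondition n p) :
    ∃ C : ℝ, 0 < C ∧
      ∀ (f : ℝ → ℝ) (u : Euc n → ℝ), ContDiff ℝ 1 f →
        IsStableRegularSolution n p (ball 0 1) f u →
        ∀ ρ ∈ Ioo (0 : ℝ) (2 / 3),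
          (∫ x in ball (0 : Euc n) ρ,
              ‖x‖ ^ (p - n) * ‖gradient u x‖ ^ (p - 2) * radialDeriv u x ^ 2)
            ≤ C * ρ ^ (p - n) *
              ∫ x in ball (0 : Euc n) (3 * ρ / 2) \ ball (0 : Euc n) ρ,
                ‖gradient u x‖ ^ p := by
  obtain ⟨C, hC, H⟩ := exists_const_stability p hp hnp hdim
  refine ⟨C, hC, fun f u hf hst ρ hρ => ?_⟩
  have hR0 : 0 < 3 * ρ / 2 := by linarith [hρ.1]
  have hR : 3 * ρ / 2 < 1 := by linarith [hρ.2]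
  obtain ⟨v, hv, hvc, hvu⟩ := exists_contDiff_extension hst.1.1 hR0 hR
  have h := H f v ρ hf hv hvc hρ.1 hR.le (hst.weakStable hR hvu) (hst.1.weakSolution hR hvu)
  rw [setIntegral_congr_fun (measurableSet_ball.diff measurableSet_ball)
    (g := fun x => ‖∇ u x‖ ^ p) fun x hx => by
      simp only [(hvu x (mem_ball_zero_iff.1 hx.1)).2]] at h
  refine le_trans (le_of_eq (setIntegral_congr_fun measurableSet_ball fun x hx => ?_)) h
  have hx : ‖x‖ < 3 * ρ / 2 := by linarith [mem_ball_zero_iff.1 hx, hρ.1]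
  simp only [radialDeriv, (hvu x hx).2]
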